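/- Let v₁, v₂ ∈ ℂ. The following are equivalent: (i) for every differential field extension L of ℂ(t), every differential subfield K of L, and every pair (y, x) ∈ L² satisfying the Hamiltonian system S_III'(v₁,v₂): t·y' = 2y²x − y² + v₁y + t and t·x' = −2yx² + 2yx − v₁x + (v₁+v₂)/2, either y and x are both algebraic over K, or y, x are algebraically independent over K; (ii) v₁ + v₂ ∉ 2ℤ and v₁ − v₂ ∉ 2ℤ, i.e. there is no integer n with v₁ + v₂ = 2n and no integer n with v₁ − v₂ = 2n. (Corollary 3.8: the solution set of S_III'(v₁,v₂) is strongly minimal if and only if v₁+v₂ ∉ 2ℤ and v₁−v₂ ∉ 2ℤ.) -/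

import Mathlib

namespace PainleveIII

open Polynomial Polynomial.Bivariate
open scoped IntermediateField Differential

section Bivariate

variable {K : Type*} [Field K]

theorem coeff_coeff_swap (F : K[X][Y]) (k l : ℕ) :
    ((Bivariate.swap F).coeff l).coeff k = (F.coeff k).coeff l := by
  induction F using Polynomial.induction_on' with
  | add p q hp hq => simp [hp, hq]
  | monomial n f =>
    induction f using Polynomial.induction_on' with
    | add p q hp hq => simp only [map_add, coeff_add, hp, hq]
    | monomial m r =>
      rw [Bivariate.swap_monomial_monomial]
      simp only [coeff_monomial]
      split_ifs <;> simp_all [coeff_monomial]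

/-- The partial derivative of `K[X][Y]` in the inner variable. -/
noncomputable def innerDeriv : Derivation ℤ K[X][Y] K[X][Y] :=
  letI : Differential K[X] := ⟨(derivative' (R := K)).restrictScalars ℤ⟩
  Differential.mapCoeffs

theorem coeff_innerDeriv (F : K[X][Y]) (k : ℕ) :
    (innerDeriv F).coeff k = derivative (F.coeff k) := rfl

theorem swap_derivative (F : K[X][Y]) :
    Bivariate.swap (derivative F) = innerDeriv (Bivariate.swap F) := by
  ext l k
  rw [coeff_coeff_swap, coeff_innerDeriv, coeff_derivative, coeff_derivative, coeff_coeff_swap]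
  rw [← Nat.cast_succ, ← Nat.cast_succ, coeff_mul_natCast]

theorem swap_innerDeriv (F : K[X][Y]) :
    Bivariate.swap (innerDeriv F) = derivative (Bivariate.swap F) := by
  rw [← Bivariate.swap_swap_apply (derivative (Bivariate.swap F)), swap_derivative,
    Bivariate.swap_swap_apply]

variable [Differential K]

/-- The derivation of `K[X][Y]` extending the one of `K` and killing both variables. -/
noncomputable def coeffDeriv : Derivation ℤ K[X][Y] K[X][Y] :=
  letI : Differential K[X] := ⟨Differential.mapCoeffs⟩
  Differential.mapCoeffs

theorem coeff_coeffDeriv (F : K[X][Y]) (k : ℕ) :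
    (coeffDeriv F).coeff k = Differential.mapCoeffs (F.coeff k) := rfl

theorem swap_coeffDeriv (F : K[X][Y]) :
    Bivariate.swap (coeffDeriv F) = coeffDeriv (Bivariate.swap F) := by
  ext l k
  rw [coeff_coeff_swap, coeff_coeffDeriv, coeff_coeffDeriv, Differential.coeff_mapCoeffs,
    Differential.coeff_mapCoeffs, coeff_coeff_swap]

/-- The derivation of `K[X][Y]` extending the one of `K`, with value `p` at the outer variable and
value `q` at the inner one. -/
noncomputable def vectorField (p q F : K[X][Y]) : K[X][Y] :=
  coeffDeriv F + p * derivative F + q * innerDeriv F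

theorem swap_vectorField (p q F : K[X][Y]) :
    Bivariate.swap (vectorField p q F) =
      vectorField (Bivariate.swap q) (Bivariate.swap p) (Bivariate.swap F) := by
  simp only [vectorField, map_add, map_mul, swap_coeffDeriv, swap_derivative, swap_innerDeriv]
  ring

variable {p₀ p₁ p₂ q₀ q₁ : K[X]}

theorem coeff_vectorField (F : K[X][Y]) (k : ℕ) :
    (vectorField (C p₂ * Y ^ 2 + C p₁ * Y + C p₀) (C q₁ * Y + C q₀) F).coeff (k + 1) =
      Differential.mapCoeffs (F.coeff (k + 1)) + k * p₂ * F.coeff k +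
        (k + 1) * p₁ * F.coeff (k + 1) + (k + 2) * p₀ * F.coeff (k + 2) +
        q₁ * derivative (F.coeff k) + q₀ * derivative (F.coeff (k + 1)) := by
  have h2 : (Y ^ 2 * derivative F).coeff (k + 1) = k * F.coeff k := by
    rcases k with - | k
    · rw [pow_two, mul_assoc, zero_add, coeff_X_mul, coeff_X_mul_zero]
      simp
    · rw [coeff_X_pow_mul, coeff_derivative]
      push_cast
      ring
  simp only [vectorField, add_mul, mul_assoc, coeff_add, coeff_C_mul, h2, coeff_X_mul,
    coeff_derivative, coeff_innerDeriv, coeff_coeffDeriv]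
  push_cast
  ring

theorem eq_of_vectorField_eq_mul [CharZero K] {F G : K[X][Y]} {s : ℕ} (hs : F.natDegree = s + 1)
    (h : vectorField (C p₂ * Y ^ 2 + C p₁ * Y + C p₀) (C q₁ * Y + C q₀) F = G * F) :
    G.natDegree ≤ 1 ∧
    (s + 1) * p₂ * F.coeff (s + 1) + q₁ * derivative (F.coeff (s + 1)) =
      G.coeff 1 * F.coeff (s + 1) ∧
    Differential.mapCoeffs (F.coeff (s + 1)) + s * p₂ * F.coeff s +
        (s + 1) * p₁ * F.coeff (s + 1) +
        q₁ * derivative (F.coeff s) + q₀ * derivative (F.coeff (s + 1)) =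
      G.coeff 1 * F.coeff s + G.coeff 0 * F.coeff (s + 1) := by
  have hF0 : F ≠ 0 := by rintro rfl; simp at hs
  have hv : ∀ k, s + 1 < k → F.coeff k = 0 := fun k hk => coeff_eq_zero_of_natDegree_lt (by omega)
  have hG : G.natDegree ≤ 1 := by
    rcases eq_or_ne G 0 with rfl | hG0
    · simp
    have : (G * F).natDegree ≤ s + 2 := by
      rw [← h, natDegree_le_iff_coeff_eq_zero]
      intro N hN
      obtain ⟨k, rfl⟩ : ∃ k, N = k + 1 := ⟨N - 1, by omega⟩
      rw [coeff_vectorField, hv k (by omega), hv (k + 1) (by omega), hv (k + 2) (by omega)]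
      simp
    rw [natDegree_mul hG0 hF0] at this
    omega
  have hGF : ∀ k, (G * F).coeff (k + 1) = G.coeff 1 * F.coeff k + G.coeff 0 * F.coeff (k + 1) := by
    intro k
    conv_lhs => rw [eq_X_add_C_of_natDegree_le_one hG]
    simp [add_mul, mul_assoc]
  refine ⟨hG, ?_, ?_⟩
  · have := hGF (s + 1)
    rw [← h, coeff_vectorField, hv (s + 1 + 1) (by omega), hv (s + 1 + 2) (by omega)] at this
    simpa using this
  · have := hGF s
    rw [← h, coeff_vectorField, hv (s + 2) (by omega)] at this
    simpa using this

end Bivariate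

section Univariate

variable {K : Type*} [Field K] [CharZero K]

theorem eq_C_of_dvd_derivative {g : K[X]} (h : g ∣ derivative g) : ∃ c, g = C c := by
  refine ⟨g.coeff 0, eq_C_of_derivative_eq_zero ?_⟩
  by_contra h0
  have := natDegree_le_of_dvd h h0
  have hg : g.natDegree ≠ 0 := by
    intro hg
    rw [eq_C_of_natDegree_eq_zero hg] at h0
    simp at h0
  have := natDegree_derivative_lt hg
  omega

/-- A polynomial dividing `X (1 - X)` times its derivative has no other roots than `0` and `1`. -/
theorem eq_mul_pow_mul_pow_of_dvd {f : K[X]} (hf : f ≠ 0)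
    (h : f ∣ X * (1 - X) * derivative f) :
    ∃ (c : K) (i j : ℕ), f = C c * (X ^ i * (X - 1) ^ j) := by
  obtain ⟨i, f₁, hf₁, rfl⟩ : ∃ i f₁, ¬ (X : K[X]) ∣ f₁ ∧ f = X ^ i * f₁ := by
    have := finiteMultiplicity_X_sub_C (0 : K) hf
    rw [C_0, sub_zero] at this
    obtain ⟨f₁, h1, h2⟩ := this.exists_eq_pow_mul_and_not_dvd
    exact ⟨_, f₁, h2, h1⟩
  have hf₁0 : f₁ ≠ 0 := by rintro rfl; simp at hf₁
  obtain ⟨j, g, hg, rfl⟩ : ∃ j g, ¬ (X - 1 : K[X]) ∣ g ∧ f₁ = (X - 1) ^ j * g := by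
    have := finiteMultiplicity_X_sub_C (1 : K) hf₁0
    rw [C_1] at this
    obtain ⟨f₁, h1, h2⟩ := this.exists_eq_pow_mul_and_not_dvd
    exact ⟨_, f₁, h2, h1⟩
  have hX : IsCoprime g (X : K[X]) :=
    (((prime_X (R := K)).irreducible.coprime_iff_not_dvd).2 fun hd => hf₁ (hd.mul_left _)).symm
  have hX1 : IsCoprime g (X - 1 : K[X]) := by
    have hp : Irreducible (X - 1 : K[X]) := by
      rw [← C_1]; exact irreducible_X_sub_C 1
    exact ((hp.coprime_iff_not_dvd).2 hg).symm
  have hd : X * (1 - X) * derivative (X ^ i * ((X - 1) ^ j * g)) =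
      X ^ i * ((X - 1) ^ j) * (g * (C (i : K) * (1 - X) - C (j : K) * X)
        + X * (1 - X) * derivative g) := by
    have e1 : X * derivative (X ^ i : K[X]) = C (i : K) * X ^ i := by
      rcases i with - | i
      · simp
      · rw [derivative_X_pow]; simp; ring
    have e2 : (X - 1) * derivative ((X - 1 : K[X]) ^ j) = C (j : K) * (X - 1) ^ j := by
      rcases j with - | j
      · simp
      · rw [derivative_pow]; simp; ring
    rw [derivative_mul, derivative_mul]
    linear_combination (1 - X) * (X - 1) ^ j * g * e1 - X * X ^ i * g * e2
  rw [hd, ← mul_assoc] at h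
  have h := (mul_dvd_mul_iff_left (mul_ne_zero (pow_ne_zero _ X_ne_zero) (by
    rintro h0; rw [h0] at hf; simp at hf))).1 h
  rw [dvd_add_right (dvd_mul_right _ _)] at h
  have hc : IsCoprime g (X * (1 - X)) := by
    refine hX.mul_right ?_
    rw [← neg_sub]
    exact hX1.neg_right
  obtain ⟨c, rfl⟩ := eq_C_of_dvd_derivative (hc.dvd_of_dvd_mul_left h)
  exact ⟨c, i, j, by ring⟩

theorem eq_C_mul_X_pow_of_dvd {f : K[X]} (hf : f ≠ 0) (h : f ∣ X ^ 2 * derivative f) :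
    ∃ (c : K) (i : ℕ), f = C c * X ^ i := by
  obtain ⟨i, f₁, hf₁, rfl⟩ : ∃ i f₁, ¬ (X : K[X]) ∣ f₁ ∧ f = X ^ i * f₁ := by
    have := finiteMultiplicity_X_sub_C (0 : K) hf
    rw [C_0, sub_zero] at this
    obtain ⟨f₁, h1, h2⟩ := this.exists_eq_pow_mul_and_not_dvd
    exact ⟨_, f₁, h2, h1⟩
  have hX : IsCoprime f₁ (X : K[X]) :=
    (((prime_X (R := K)).irreducible.coprime_iff_not_dvd).2 hf₁).symm
  have hd : X ^ 2 * derivative (X ^ i * f₁) =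
      X ^ i * (f₁ * (C (i : K) * X) + X ^ 2 * derivative f₁) := by
    have e1 : X * derivative (X ^ i : K[X]) = C (i : K) * X ^ i := by
      rcases i with - | i
      · simp
      · rw [derivative_X_pow]; simp; ring
    rw [derivative_mul]
    linear_combination X * f₁ * e1
  rw [hd] at h
  have h := (mul_dvd_mul_iff_left (pow_ne_zero _ X_ne_zero)).1 h
  rw [dvd_add_right (dvd_mul_right _ _)] at h
  obtain ⟨c, rfl⟩ := eq_C_of_dvd_derivative ((hX.pow_right (n := 2)).dvd_of_dvd_mul_left h)
  exact ⟨c, i, by ring⟩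

/-- The equation `2 X (1 - X) u' = (2 i + 1 + e X) u` has no nonzero polynomial solution, because
its exponent at `0` is a half-integer. -/
theorem eq_zero_of_half_integer_exponent {u e : K[X]} {i : ℕ}
    (h : 2 * X * (1 - X) * derivative u = (2 * C (i : K) + 1 + e * X) * u) : u = 0 := by
  by_contra hu
  obtain ⟨k, f₁, hf₁, rfl⟩ : ∃ i f₁, ¬ (X : K[X]) ∣ f₁ ∧ u = X ^ i * f₁ := by
    have := finiteMultiplicity_X_sub_C (0 : K) hu
    rw [C_0, sub_zero] at this
    obtain ⟨f₁, h1, h2⟩ := this.exists_eq_pow_mul_and_not_dvd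
    exact ⟨_, f₁, h2, h1⟩
  have e1 : X * derivative (X ^ k : K[X]) = C (k : K) * X ^ k := by
    rcases k with - | i
    · simp
    · rw [derivative_X_pow]; simp; ring
  have h2 : X ^ k * (2 * (1 - X) * C (k : K) * f₁ + 2 * X * (1 - X) * derivative f₁) =
      X ^ k * ((2 * C (i : K) + 1 + e * X) * f₁) := by
    rw [derivative_mul] at h
    linear_combination h - 2 * (1 - X) * f₁ * e1
  have h3 := congrArg (eval 0) (mul_left_cancel₀ (pow_ne_zero _ X_ne_zero) h2)
  have h0 : eval 0 f₁ ≠ 0 := by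
    rwa [← coeff_zero_eq_eval_zero, Ne, ← X_dvd_iff]
  simp at h3
  rcases h3 with h3 | h3
  · norm_cast at h3
    omega
  · exact h0 h3

end Univariate

section Darboux

variable {K : Type*} [Field K] [CharZero K]

theorem coeff_of_ode {φ : K[X]} {s : ℕ} {A B D : K}
    (h : 2 * X * (X * derivative φ - C (s : K) * φ) = X ^ s * (C A * X ^ 2 + C B * X + C D))
    (k : ℕ) : 2 * ((k : K) - s) * φ.coeff k =
      (if k = s + 1 then A else 0) + (if k = s then B else 0) + (if k + 1 = s then D else 0) := by
  have h1 : (X * derivative φ).coeff k = k * φ.coeff k := by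
    rcases k with - | k
    · simp
    · rw [coeff_X_mul, coeff_derivative]; push_cast; ring
  have h2 : X ^ s * (C A * X ^ 2 + C B * X + C D) =
      C A * X ^ (s + 2) + C B * X ^ (s + 1) + C D * X ^ s := by ring
  have := congrArg (coeff · (k + 1)) h
  rw [h2, ← C_ofNat, mul_assoc] at this
  beta_reduce at this
  simp only [coeff_C_mul, coeff_X_mul, coeff_sub, h1, coeff_add, coeff_X_pow, mul_ite,
    mul_one, mul_zero, add_left_inj] at this
  linear_combination this

theorem coeff_zero_of_ode {φ : K[X]} {A B D : K}
    (h : 2 * X * (X * derivative φ - C ((0 : ℕ) : K) * φ) =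
      X ^ 0 * (C A * X ^ 2 + C B * X + C D)) : D = 0 := by
  have := congrArg (coeff · 0) h
  simpa [mul_assoc, pow_two] using this.symm

theorem eq_of_ode {φ : K[X]} {t : ℕ} {A B D : K}
    (h : 2 * X * (X * derivative φ - C ((t + 1 : ℕ) : K) * φ) =
      X ^ (t + 1) * (C A * X ^ 2 + C B * X + C D)) :
    B = 0 ∧ φ = C (A / 2) * X ^ (t + 2) + C (φ.coeff (t + 1)) * X ^ (t + 1)
      + C (-D / 2) * X ^ t := by
  have hc := coeff_of_ode h
  refine ⟨by simpa using (hc (t + 1)).symm, ?_⟩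
  ext k
  simp only [coeff_add, coeff_C_mul, coeff_X_pow, mul_ite, mul_one, mul_zero]
  have hk := hc k
  by_cases h0 : k = t + 1
  · simp [h0]
  have h1 : (k : K) - (t + 1 : ℕ) ≠ 0 := sub_ne_zero.2 (by exact_mod_cast h0)
  by_cases h2 : k = t + 2
  · subst h2
    simp at hk ⊢
    linear_combination hk / 2
  by_cases h3 : k = t
  · subst h3
    simp [show k ≠ k + 1 + 1 by omega] at hk ⊢
    linear_combination -hk / 2
  simp [h0, h2, h3] at hk ⊢
  exact hk.resolve_left (by simpa using h1)

variable [Differential K]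

theorem mapCoeffs_X_pow (n : ℕ) : Differential.mapCoeffs (X ^ n : K[X]) = 0 := by
  ext k
  rw [Differential.coeff_mapCoeffs, coeff_X_pow]
  split_ifs <;> simp

theorem mapCoeffs_X_sub_one_pow (n : ℕ) : Differential.mapCoeffs ((X - 1) ^ n : K[X]) = 0 := by
  have h : Differential.mapCoeffs (X - 1 : K[X]) = 0 := by
    rw [map_sub, Derivation.map_one_eq_zero, sub_zero]
    simpa using mapCoeffs_X_pow (K := K) 1
  rw [Derivation.leibniz_pow, h]
  simp

theorem mapCoeffs_X_mul_pow (i j : ℕ) :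
    Differential.mapCoeffs (X ^ i * (X - 1) ^ j : K[X]) = 0 := by
  rw [Derivation.leibniz, mapCoeffs_X_pow, mapCoeffs_X_sub_one_pow]
  simp

/-- The velocity of `y` for the Painlevé III system, as a polynomial in `x` (inner variable) and
`y` (outer variable). -/
noncomputable def velocityY (a b θ : K) : K[X][Y] :=
  C (2 * X - 1) * Y ^ 2 + C (C (a + b)) * Y + C (C θ)

/-- The velocity of `x` for the Painlevé III system, as a polynomial in `x` (inner variable) and
`y` (outer variable). -/
noncomputable def velocityX (a b : K) : K[X][Y] :=
  C (2 * X - 2 * X ^ 2) * Y + C (C a - C (a + b) * X)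

theorem swap_velocityY (a b θ : K) :
    Bivariate.swap (velocityY a b θ) =
      C (2 * X ^ 2) * Y + C (-X ^ 2 + C (a + b) * X + C θ) := by
  simp [velocityY, Bivariate.swap_apply]
  ring_nf
  simp only [C_ofNat]

theorem swap_velocityX (a b : K) :
    Bivariate.swap (velocityX a b) =
      C (-2 * X) * Y ^ 2 + C (2 * X - C (a + b)) * Y + C (C a) := by
  simp only [velocityX, Bivariate.swap_apply]
  have : (C (C (2 : K)) : K[X][Y]) = C 2 := by rw [C_ofNat]
  simp
  ring_nf
  simp only [C_ofNat]

theorem eq_top_of_le {n m k i j : ℕ} (h : (2 : K) * (n - i - j) = 2 * (k - m)) (hk : k ≤ n)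
    (hij : i + j ≤ m) : k = n ∧ i + j = m := by
  have : ((n + m : ℕ) : K) = ((k + i + j : ℕ) : K) := by
    push_cast
    linear_combination h / 2
  have := Nat.cast_injective this
  omega

/-- The shape of the two top coefficients, in either variable, of a Darboux polynomial of the
Painlevé III system. -/
theorem coeff_eq_of_darboux {a b θ : K} (hθ : θ ≠ 0) {F G : K[X][Y]} (hn : F.natDegree ≠ 0)
    (hm : (Bivariate.swap F).natDegree ≠ 0) (hF : F.leadingCoeff.Monic)
    (h : vectorField (velocityY a b θ) (velocityX a b) F = G * F) :
    ∃ i j t : ℕ, F.natDegree = t + 2 ∧ (Bivariate.swap F).natDegree = i + j ∧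
      X * (1 - X) * F.coeff (t + 1) = F.coeff (t + 2) * (C (i * a) * (1 - X) - C (j * b) * X) ∧
      (Bivariate.swap F).coeff (i + j) = X ^ (t + 2) ∧
      (Bivariate.swap F).coeff (i + j - 1) =
        -C (j : K) * X ^ (t + 2) + C (i * a + j * b) * X ^ (t + 1)
          + C ((t + 2) / 2 * θ) * X ^ t := by
  obtain ⟨s, hs⟩ := Nat.exists_eq_succ_of_ne_zero hn
  obtain ⟨r, hr⟩ := Nat.exists_eq_succ_of_ne_zero hm
  have h' : vectorField (Bivariate.swap (velocityX a b)) (Bivariate.swap (velocityY a b θ))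
      (Bivariate.swap F) = Bivariate.swap G * Bivariate.swap F := by
    rw [← swap_vectorField, h, map_mul]
  rw [swap_velocityX, swap_velocityY] at h'
  obtain ⟨hG, ht, hnext⟩ := eq_of_vectorField_eq_mul hs h
  obtain ⟨hG', ht', hnext'⟩ := eq_of_vectorField_eq_mul hr h'
  have hf1 : (F.coeff (s + 1)).Monic := by rwa [leadingCoeff, hs] at hF
  have hf0 : F.coeff (s + 1) ≠ 0 := hf1.ne_zero
  have hg0 : (Bivariate.swap F).coeff (r + 1) ≠ 0 := by
    have : Bivariate.swap F ≠ 0 := by intro h0; rw [h0] at hm; simp at hm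
    rwa [← leadingCoeff_ne_zero, leadingCoeff, hr] at this
  -- leading coefficient in `y`
  obtain ⟨c, i, j, hf⟩ := eq_mul_pow_mul_pow_of_dvd hf0
    ⟨C (1 / 2) * (G.coeff 1 - ((s : K[X]) + 1) * (2 * X - 1)), by
      have e : (C (1 / 2) : K[X]) * 2 = 1 := by
        rw [← C_ofNat, ← C_mul]; simp
      linear_combination C (1 / 2) * ht -
        (X * (1 - X) * derivative (F.coeff (s + 1))) * e⟩
  have hc : c = 1 := by
    have h1 : (X ^ i * (X - 1) ^ j : K[X]).Monic :=
      (monic_X_pow i).mul (by rw [← C_1]; exact (monic_X_sub_C (1 : K)).pow j)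
    have := hf1
    rw [hf, Monic, leadingCoeff_mul, h1.leadingCoeff] at this
    simpa using this
  rw [hc, C_1, one_mul] at hf
  have hfdeg : (F.coeff (s + 1)).natDegree = i + j := by
    rw [hf, ← C_1, natDegree_mul (by simp) (pow_ne_zero _ (X_sub_C_ne_zero _)), natDegree_pow,
      natDegree_pow, natDegree_X_sub_C]
    simp
  have hfd : X * (1 - X) * derivative (F.coeff (s + 1)) =
      F.coeff (s + 1) * (C (i : K) * (1 - X) - C (j : K) * X) := by
    have e1 : X * derivative (X ^ i : K[X]) = C (i : K) * X ^ i := by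
      rcases i with - | i
      · simp
      · rw [derivative_X_pow]; simp; ring
    have e2 : (X - 1) * derivative ((X - 1 : K[X]) ^ j) = C (j : K) * (X - 1) ^ j := by
      rcases j with - | j
      · simp
      · rw [derivative_pow]; simp; ring
    rw [hf, derivative_mul]
    linear_combination (1 - X) * (X - 1) ^ j * e1 - X * X ^ i * e2
  have hg1 : G.coeff 1 = C (2 * ((s + 1 : ℕ) - i - j : K)) * X + C (2 * i - (s + 1 : ℕ) : K) := by
    refine mul_right_cancel₀ hf0 ?_
    rw [← ht]
    simp only [C_mul, C_sub, map_natCast, C_ofNat]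
    push_cast
    simp only [map_natCast] at hfd
    linear_combination 2 * hfd
  -- leading coefficient in `x`
  obtain ⟨c', k, hg⟩ := eq_C_mul_X_pow_of_dvd hg0
    ⟨C (1 / 2) * ((Bivariate.swap G).coeff 1 - ((r : K[X]) + 1) * (-2 * X)), by
      have e : (C (1 / 2) : K[X]) * 2 = 1 := by
        rw [← C_ofNat, ← C_mul]; simp
      linear_combination C (1 / 2) * ht' -
        (X ^ 2 * derivative ((Bivariate.swap F).coeff (r + 1))) * e⟩
  have hgd : X * derivative ((Bivariate.swap F).coeff (r + 1)) =
      C (k : K) * (Bivariate.swap F).coeff (r + 1) := by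
    rw [hg]
    rcases k with - | k
    · simp
    · rw [derivative_C_mul, derivative_X_pow]; simp; ring
  have hh1 : (Bivariate.swap G).coeff 1 = C (2 * (k - (r + 1 : ℕ)) : K) * X := by
    refine mul_right_cancel₀ hg0 ?_
    rw [← ht']
    simp only [C_mul, C_sub, map_natCast, C_ofNat]
    push_cast
    simp only [map_natCast] at hgd
    linear_combination 2 * X * hgd
  have hc'0 : c' ≠ 0 := by rintro rfl; simp [hg] at hg0
  have hks : k ≤ s + 1 := by
    by_contra hk
    have := coeff_coeff_swap F k (r + 1)
    rw [hg, coeff_eq_zero_of_natDegree_lt (n := k) (by omega : F.natDegree < k)] at this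
    simp [hc'0] at this
  have hijr : i + j ≤ r + 1 := by
    by_contra hk
    have := coeff_coeff_swap F (s + 1) (i + j)
    rw [coeff_eq_zero_of_natDegree_lt (by omega : (Bivariate.swap F).natDegree < i + j),
      ← hfdeg] at this
    exact hf0 (leadingCoeff_eq_zero.1 this.symm)
  obtain ⟨rfl, hij⟩ : k = s + 1 ∧ i + j = r + 1 := by
    refine eq_top_of_le (K := K) ?_ hks hijr
    have := coeff_coeff_swap G 1 1
    rw [hh1, hg1] at this
    simpa [coeff_one] using this.symm
  have hc' : c' = 1 := by
    have := coeff_coeff_swap F (s + 1) (r + 1)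
    rw [hg, ← hij, ← hfdeg, hf1.coeff_natDegree] at this
    simpa using this
  rw [hc', C_1, one_mul] at hg
  obtain ⟨κ, hκ⟩ : ∃ κ, G.coeff 0 = C κ := by
    refine ⟨(G.coeff 0).coeff 0, ?_⟩
    ext l
    rcases l with - | l
    · simp
    · rw [← coeff_coeff_swap]
      rcases l with - | l
      · simp [hh1, coeff_C, coeff_one]
      · rw [coeff_eq_zero_of_natDegree_lt (by omega : (Bivariate.swap G).natDegree < l + 1 + 1)]
        simp [coeff_C]
  have hh0 : (Bivariate.swap G).coeff 0 = C (2 * i - (s + 1 : ℕ) : K) * X + C κ := by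
    ext l
    rw [coeff_coeff_swap]
    rcases l with - | l
    · simp [hκ]
    · rcases l with - | l
      · simp [hg1, coeff_C, coeff_one]
      · rw [coeff_eq_zero_of_natDegree_lt (by omega : G.natDegree < l + 1 + 1)]
        simp [coeff_X, coeff_C, coeff_one]
  have hijK : (i : K) + j = r + 1 := by exact_mod_cast hij
  -- next coefficient in `x`
  set φ := (Bivariate.swap F).coeff r with hφ
  rw [hg, mapCoeffs_X_pow, hh0, hh1, derivative_X_pow] at hnext'
  have hode : 2 * X * (X * derivative φ - C (s : K) * φ) =
      X ^ s * (C (-2 * j : K) * X ^ 2 + C (κ - (s - r : K) * (a + b)) * X +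
        C (-((s + 1 : K) * θ))) := by
    rw [show (j : K) = r + 1 - i by linear_combination hijK]
    simp only [C_mul, C_add, C_sub, C_neg, map_natCast, C_1, C_ofNat, Nat.add_sub_cancel] at hnext' ⊢
    push_cast at hnext' ⊢
    linear_combination hnext'
  obtain ⟨t, rfl⟩ : ∃ t, s = t + 1 := by
    refine Nat.exists_eq_succ_of_ne_zero ?_
    rintro rfl
    have := coeff_zero_of_ode hode
    simp [hθ] at this
  obtain ⟨hκ0, hφe⟩ := eq_of_ode hode
  -- next coefficient in `y`
  set ψ := F.coeff (t + 1) with hψ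
  have hu : X * (1 - X) * ψ - F.coeff (t + 1 + 1) * (C (i * a) * (1 - X) - C (j * b) * X) = 0 := by
    refine eq_zero_of_half_integer_exponent (i := i) (e := C (-2 * (i + j + 1) : K)) ?_
    rw [hg1, hκ, hf, mapCoeffs_X_mul_pow, ← hf] at hnext
    have hκ' : κ = ((t + 1 : ℕ) - (i + j - 1 : K)) * (a + b) := by
      linear_combination hκ0 + (a + b) * hijK
    rw [hκ'] at hnext
    simp only [derivative_mul, derivative_sub, derivative_C, derivative_X, derivative_one]
    simp only [C_mul, C_add, C_sub, C_neg, map_natCast, C_1, C_ofNat] at hnext hfd ⊢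
    push_cast at hnext ⊢
    linear_combination X * (1 - X) * hnext -
      (2 * ((i : K[X]) * C a * (1 - X) - (j : K[X]) * C b * X) + (C a - (C a + C b) * X)) * hfd
  have hrest : φ.coeff (t + 1) = i * a + j * b := by
    have h1 := congrArg (coeff · (i + j + 1)) hu
    have h2 : φ.coeff (t + 1) = ψ.coeff (i + j - 1) := by
      rw [hij, hφ, coeff_coeff_swap]; simp [hψ]
    have h3 : ψ.coeff (i + j) = 0 := by
      rw [hij, hψ, ← coeff_coeff_swap, hg, coeff_X_pow]; simp
    have h4 : (F.coeff (t + 1 + 1)).coeff (i + j) = 1 := by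
      rw [← hfdeg]; exact hf1.coeff_natDegree
    have h5 : (F.coeff (t + 1 + 1)).coeff (i + j + 1) = 0 :=
      coeff_eq_zero_of_natDegree_lt (by omega)
    obtain ⟨l, hl⟩ : ∃ l, i + j = l + 1 := ⟨r, hij⟩
    have e : X * (1 - X) * ψ - F.coeff (t + 1 + 1) * (C (i * a) * (1 - X) - C (j * b) * X) =
      X * ψ - X * (X * ψ) - C (i * a) * F.coeff (t + 1 + 1) +
        C (i * a + j * b) * (X * F.coeff (t + 1 + 1)) := by rw [C_add]; ring
    rw [e, hl] at h1
    rw [hl] at h2 h3 h4 h5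
    simp only [coeff_sub, coeff_add, coeff_C_mul, coeff_X_mul, h3, h4, h5, coeff_zero] at h1
    rw [h2, Nat.add_sub_cancel]
    linear_combination -h1
  refine ⟨i, j, t, hs, by omega, ?_, ?_, ?_⟩
  · linear_combination hu
  · rw [hij, hg]
  · rw [hij, Nat.add_sub_cancel, ← hφ, hφe, hrest]
    have e1 : -2 * (j : K) / 2 = - j := by ring
    have e2 : -(-(((t + 1 : ℕ) + 1 : K) * θ)) / 2 = (t + 2) / 2 * θ := by push_cast; ring
    rw [e1, e2, C_neg]

end Darboux

section Kernel

variable {K L : Type*} [Field K] [Field L] [Algebra K L] {x y : L}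

theorem coe_aeval_gen (p : K[X]) :
    (aeval (IntermediateField.AdjoinSimple.gen K x) p : L) = aeval x p := by
  change algebraMap K⟮x⟯ L (aeval (IntermediateField.AdjoinSimple.gen K x) p) = _
  rw [← aeval_algebraMap_apply, IntermediateField.AdjoinSimple.algebraMap_gen]

/-- For `x` transcendental, `K(x)` is the field of fractions of `K[X]`. -/
theorem isFractionRing_adjoin_simple (hx : Transcendental K x) :
    letI : Algebra K[X] K⟮x⟯ := (aeval (IntermediateField.AdjoinSimple.gen K x)).toAlgebra
    IsFractionRing K[X] K⟮x⟯ := by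
  let : Algebra K[X] K⟮x⟯ := (aeval (IntermediateField.AdjoinSimple.gen K x)).toAlgebra
  have hinj : Function.Injective (algebraMap K[X] K⟮x⟯) := by
    rw [injective_iff_map_eq_zero]
    intro p hp
    refine (transcendental_iff.1 hx) p ?_
    rw [← coe_aeval_gen, show aeval (IntermediateField.AdjoinSimple.gen K x) p = 0 from hp,
      ZeroMemClass.coe_zero]
  have : FaithfulSMul K[X] K⟮x⟯ := (faithfulSMul_iff_algebraMap_injective _ _).2 hinj
  refine IsFractionRing.of_field _ _ fun z => ?_
  obtain ⟨r, s, h⟩ := (IntermediateField.mem_adjoin_simple_iff K (z : L)).1 z.2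
  refine ⟨r, s, Subtype.ext ?_⟩
  rw [h, ← coe_aeval_gen r, ← coe_aeval_gen s]
  rfl

/-- Gauss' lemma for an irreducible relation `F (x, y) = 0` with `x` transcendental. -/
theorem minpoly_of_irreducible (hx : Transcendental K x) {F : K[X][Y]} (hF : Irreducible F)
    (hd : F.natDegree ≠ 0) (h0 : aevalAeval x y F = 0) :
    (∀ P : K[X][Y], aevalAeval x y P = 0 → F ∣ P) ∧
    (minpoly K⟮x⟯ y).natDegree = F.natDegree ∧
    ∀ k, ((minpoly K⟮x⟯ y).coeff k : L) =
      aeval x (F.coeff k) / aeval x (F.coeff F.natDegree) := by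
  let : Algebra K[X] K⟮x⟯ := (aeval (IntermediateField.AdjoinSimple.gen K x)).toAlgebra
  have hval (p : K[X]) : (algebraMap K[X] K⟮x⟯ p : L) = aeval x p := coe_aeval_gen p
  have : IsFractionRing K[X] K⟮x⟯ := isFractionRing_adjoin_simple hx
  have hinj := IsFractionRing.injective K[X] K⟮x⟯
  have hev (P : K[X][Y]) : aeval y (P.map (algebraMap K[X] K⟮x⟯)) = aevalAeval x y P := by
    induction P using Polynomial.induction_on' with
    | add p q hp hq => simp only [Polynomial.map_add, map_add, hp, hq]
    | monomial n f =>
      rw [map_monomial, aeval_monomial, ← C_mul_X_pow_eq_monomial, map_mul, map_pow,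
        aevalAeval_C, aevalAeval_Y, ← hval]
      rfl
  have hprim : F.IsPrimitive := hF.isPrimitive hd
  have hirr : Irreducible (F.map (algebraMap K[X] K⟮x⟯)) :=
    (hprim.irreducible_iff_irreducible_map_fraction_map).1 hF
  have hroot : aeval y (F.map (algebraMap K[X] K⟮x⟯)) = 0 := by rw [hev, h0]
  have hmin := minpoly.eq_of_irreducible hirr hroot
  have hlc : (F.map (algebraMap K[X] K⟮x⟯)).leadingCoeff ≠ 0 :=
    leadingCoeff_ne_zero.2 hirr.ne_zero
  have hdeg : (F.map (algebraMap K[X] K⟮x⟯)).natDegree = F.natDegree :=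
    natDegree_map_eq_of_injective hinj F
  refine ⟨fun P hP => ?_, ?_, fun k => ?_⟩
  · refine hprim.dvd_of_fraction_map_dvd_fraction_map (K := K⟮x⟯) ?_
    rw [← hirr.dvd_iff_aeval_eq_zero hroot, hev, hP]
  · rw [← hmin, natDegree_mul_C (inv_ne_zero hlc), hdeg]
  · rw [← hmin, coeff_mul_C, leadingCoeff, hdeg, coeff_map, coeff_map, ← hval, ← hval,
      div_eq_mul_inv]
    push_cast
    rfl

theorem algEquiv_swap_irreducible {F : K[X][Y]} (hF : Irreducible F) :
    Irreducible (Bivariate.swap F) :=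
  (MulEquiv.irreducible_iff (Bivariate.swap (R := K))).2 hF

/-- If `x` and `y` are transcendental and dependent then they satisfy an irreducible relation
generating all relations, and it can be normalised. -/
theorem exists_irreducible_relation (hx : Transcendental K x) (hy : Transcendental K y)
    {P : K[X][Y]} (hP : P ≠ 0) (hP0 : aevalAeval x y P = 0) :
    ∃ F : K[X][Y], Irreducible F ∧ F.leadingCoeff.Monic ∧ F.natDegree ≠ 0 ∧
      (Bivariate.swap F).natDegree ≠ 0 ∧ aevalAeval x y F = 0 := by
  have hprime : (RingHom.ker (aevalAeval (R := K) x y)).IsPrime := RingHom.ker_isPrime _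
  obtain ⟨F, hF, hFp⟩ := hprime.exists_mem_prime_of_ne_bot (by
    rw [Ne, Submodule.eq_bot_iff]
    exact fun h => hP (h P hP0))
  have hF0 : aevalAeval x y F = 0 := hF
  have aux : ∀ (u v : L) (F : K[X][Y]), Transcendental K u → F ≠ 0 → aevalAeval u v F = 0 →
      F.natDegree ≠ 0 := by
    intro u v F hu hF h0 hd
    obtain ⟨c, rfl⟩ := natDegree_eq_zero.1 hd
    rw [aevalAeval_C] at h0
    exact hF (by rw [(transcendental_iff.1 hu) c h0, C_0])
  have hl : F.leadingCoeff.leadingCoeff ≠ 0 := by simpa using hFp.ne_zero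
  have hu : IsUnit (C (C F.leadingCoeff.leadingCoeff⁻¹) : K[X][Y]) :=
    ((IsUnit.mk0 _ (inv_ne_zero hl)).map C).map C
  have hirr : Irreducible (C (C F.leadingCoeff.leadingCoeff⁻¹) * F) :=
    (irreducible_isUnit_mul hu).2 hFp.irreducible
  refine ⟨C (C F.leadingCoeff.leadingCoeff⁻¹) * F, hirr, ?_, ?_, ?_, ?_⟩
  · rw [leadingCoeff_mul, leadingCoeff_C, Monic, leadingCoeff_mul, leadingCoeff_C,
      inv_mul_cancel₀ hl]
  · exact aux x y _ hx hirr.ne_zero (by rw [map_mul, hF0, mul_zero])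
  · exact aux y x _ hy (algEquiv_swap_irreducible hirr).ne_zero
      (by rw [Bivariate.aevalAeval_swap, map_mul, hF0, mul_zero])
  · rw [map_mul, hF0, mul_zero]

theorem exists_relation_of_isAlgebraic (hx : Transcendental K x) (h : IsAlgebraic K⟮x⟯ y) :
    ∃ P : K[X][Y], P ≠ 0 ∧ aevalAeval x y P = 0 := by
  let : Algebra K[X] K⟮x⟯ := (aeval (IntermediateField.AdjoinSimple.gen K x)).toAlgebra
  let : Algebra K[X] L := (aeval x).toAlgebra
  have : IsFractionRing K[X] K⟮x⟯ := isFractionRing_adjoin_simple hx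
  have : IsScalarTower K[X] K⟮x⟯ L := IsScalarTower.of_algebraMap_eq fun p =>
    (coe_aeval_gen p).symm
  obtain ⟨P, hP, hP0⟩ := (IsFractionRing.isAlgebraic_iff K[X] K⟮x⟯ L).2 h
  refine ⟨P, hP, ?_⟩
  rw [← hP0, aeval_def, eval₂_eq_sum_range]
  conv_lhs => rw [P.as_sum_range_C_mul_X_pow, map_sum]
  simp only [map_mul, map_pow, aevalAeval_C, aevalAeval_Y]
  rfl

variable [Differential K] [Differential L] [DifferentialAlgebra K L]

theorem deriv_aevalAeval {p q : K[X][Y]} (hy : y′ = aevalAeval x y p) (hx : x′ = aevalAeval x y q)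
    (F : K[X][Y]) : (aevalAeval x y F)′ = aevalAeval x y (vectorField p q F) := by
  induction F using Polynomial.induction_on' with
  | add f g hf hg =>
    have : vectorField p q (f + g) = vectorField p q f + vectorField p q g := by
      simp only [vectorField, map_add]; ring
    rw [this, map_add, map_add, map_add, hf, hg]
  | monomial n f =>
    have h1 : coeffDeriv (monomial n f) = C (Differential.mapCoeffs f) * Y ^ n := by
      ext k : 1
      rw [coeff_coeffDeriv, coeff_monomial, coeff_C_mul, coeff_X_pow]
      by_cases h : n = k
      · simp [h]
      · simp [h, Ne.symm h]
    have h2 : innerDeriv (monomial n f) = C (derivative f) * Y ^ n := by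
      ext k : 1
      rw [coeff_innerDeriv, coeff_monomial, coeff_C_mul, coeff_X_pow]
      by_cases h : n = k
      · simp [h]
      · simp [h, Ne.symm h]
    rw [vectorField, h1, h2, derivative_monomial, ← C_mul_X_pow_eq_monomial,
      ← C_mul_X_pow_eq_monomial]
    simp only [map_add, map_mul, map_pow, aevalAeval_C, aevalAeval_Y, ← hy, ← hx, map_natCast]
    rw [Derivation.leibniz, Derivation.leibniz_pow, Differential.deriv_aeval_eq]
    simp only [smul_eq_mul, nsmul_eq_mul]
    ring

end Kernel

section MinpolyAffine

variable {E L : Type*} [Field E] [Field L] [Algebra E L]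

theorem coeff_taylor_of_monic {p : E[X]} (hp : p.Monic) {n : ℕ} (hn : p.natDegree = n + 1)
    (r : E) : (taylor r p).coeff n = p.coeff n + (n + 1) * r := by
  have hd : (hasseDeriv n p).natDegree ≤ 1 := by
    have := natDegree_hasseDeriv_le p n
    omega
  have h1 : p.coeff (n + 1) = 1 := by rw [← hn]; exact hp.coeff_natDegree
  rw [taylor_coeff, eq_X_add_C_of_natDegree_le_one hd, hasseDeriv_coeff, hasseDeriv_coeff,
    add_comm 1 n, h1]
  simp [Nat.choose_succ_self_right]
  ring

/-- The effect of an affine change of generator on the minimal polynomial. -/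
theorem coeff_minpoly_affine {z : L} {u : E} (hu : u ≠ 0) (v : E) {n : ℕ}
    (hn : (minpoly E z).natDegree = n + 1) :
    (minpoly E (algebraMap E L u * z + algebraMap E L v)).natDegree = n + 1 ∧
    (minpoly E (algebraMap E L u * z + algebraMap E L v)).coeff n =
      u * (minpoly E z).coeff n - (n + 1) * v := by
  have hz : IsIntegral E z := by
    by_contra h
    rw [minpoly.eq_zero h] at hn
    simp at hn
  have hm : ((minpoly E z).scaleRoots u).Monic := (monic_scaleRoots_iff u).2 (minpoly.monic hz)
  have hd : ((minpoly E z).scaleRoots u).natDegree = n + 1 := by rw [natDegree_scaleRoots, hn]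
  rw [minpoly.add_algebraMap, ← Algebra.smul_def, IsIntegrallyClosed.minpoly_smul hu hz,
    sub_eq_add_neg, ← C_neg]
  change (taylor (-v) _).natDegree = n + 1 ∧ (taylor (-v) _).coeff n = _
  rw [natDegree_taylor, hd, coeff_taylor_of_monic hm hd, coeff_scaleRoots, hn]
  refine ⟨rfl, ?_⟩
  simp
  ring

end MinpolyAffine

theorem isAlgebraic_adjoin_symm {K L : Type*} [Field K] [Field L] [Algebra K L] {x y : L}
    (hx : Transcendental K x) (hy : Transcendental K y) (h : IsAlgebraic K⟮x⟯ y) :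
    IsAlgebraic K⟮y⟯ x := by
  obtain ⟨P, hP, hP0⟩ := exists_relation_of_isAlgebraic hx h
  obtain ⟨F, hF, -, -, hm, hF0⟩ := exists_irreducible_relation hx hy hP hP0
  obtain ⟨-, hdeg, -⟩ := minpoly_of_irreducible (x := y) (y := x) hy
    (algEquiv_swap_irreducible hF) hm (by rw [Bivariate.aevalAeval_swap, hF0])
  by_contra h
  rw [minpoly.eq_zero (fun hi => h hi.isAlgebraic)] at hdeg
  exact hm (by rw [← hdeg, natDegree_zero])

section Solution

variable {K L : Type*} [Field K] [Field L] [Algebra K L] [Differential K] [Differential L]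
  [DifferentialAlgebra K L]

theorem deriv_mem_algebraicClosure [CharZero K] {z : L} (hz : z ∈ algebraicClosure K L) :
    z′ ∈ algebraicClosure K L := by
  have hi : IsIntegral K z := (mem_algebraicClosure_iff.1 hz).isIntegral
  have hmem (q : K[X]) : aeval z q ∈ algebraicClosure K L := by
    have := aeval_algebraMap_apply L (⟨z, hz⟩ : algebraicClosure K L) q
    rw [show z = algebraMap (algebraicClosure K L) L ⟨z, hz⟩ from rfl, this]
    exact SetLike.coe_mem _
  have h0 := (minpoly.irreducible hi).separable.aeval_derivative_ne_zero (minpoly.aeval K z)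
  have h1 := Differential.deriv_aeval_eq z (minpoly K z)
  rw [minpoly.aeval, map_zero] at h1
  have h2 : z′ = -aeval z (Differential.mapCoeffs (minpoly K z)) /
      aeval z (derivative (minpoly K z)) := by
    rw [eq_div_iff h0]
    linear_combination -h1
  rw [h2]
  exact div_mem (neg_mem (hmem _)) (hmem _)

/-- A pair `(y, x)` solving the Painlevé III Hamiltonian system, for the derivation `t d/dt`, with
parameters `a = (v₁ + v₂) / 2` and `b = (v₁ - v₂) / 2`. -/
structure IsSolution (a b θ : K) (y x : L) : Prop where
  deriv_a : a′ = 0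
  deriv_b : b′ = 0
  deriv_θ : θ′ = θ
  θ_ne_zero : θ ≠ 0
  deriv_y : y′ = 2 * y ^ 2 * x - y ^ 2 + algebraMap K L (a + b) * y + algebraMap K L θ
  deriv_x : x′ = -(2 * y * x ^ 2) + 2 * y * x - algebraMap K L (a + b) * x + algebraMap K L a

/-- A pair `(y, x)` of dependent transcendental elements solving the Painlevé III Hamiltonian
system with non-integral parameters `a` and `b`. -/
structure DependentSolution (a b θ : K) (y x : L) : Prop extends IsSolution a b θ y x where
  a_ne (n : ℤ) : a ≠ n
  b_ne (n : ℤ) : b ≠ n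
  transcendental_x : Transcendental K x
  transcendental_y : Transcendental K y
  isAlgebraic : IsAlgebraic K⟮x⟯ y

namespace IsSolution

variable {a b θ : K} {y x : L}

theorem y_ne_zero (h : IsSolution a b θ y x) : y ≠ 0 := by
  rintro rfl
  have hy := h.deriv_y
  simp at hy
  exact h.θ_ne_zero ((map_eq_zero (algebraMap K L)).1 hy.symm)

theorem x_ne_zero (h : IsSolution a b θ y x) (ha : a ≠ 0) : x ≠ 0 := by
  rintro rfl
  have hx := h.deriv_x
  simp at hx
  exact ha ((map_eq_zero (algebraMap K L)).1 hx.symm)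

theorem one_sub_x_ne_zero (h : IsSolution a b θ y x) (hb : b ≠ 0) : 1 - x ≠ 0 := by
  intro h1
  obtain rfl : x = 1 := by linear_combination -h1
  have hx := h.deriv_x
  rw [Derivation.map_one_eq_zero, map_add] at hx
  exact hb ((map_eq_zero (algebraMap K L)).1 (by linear_combination hx))

variable [CharZero K]

theorem x_mem (h : IsSolution a b θ y x) (hy : y ∈ algebraicClosure K L) :
    x ∈ algebraicClosure K L := by
  have h0 := h.y_ne_zero
  have h2 : (2 : L) ≠ 0 := by
    have : CharZero L := charZero_of_injective_algebraMap (algebraMap K L).injective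
    simp
  have e : x = (y′ + y ^ 2 - algebraMap K L (a + b) * y - algebraMap K L θ) / (2 * y ^ 2) := by
    rw [eq_div_iff (mul_ne_zero h2 (pow_ne_zero _ h0))]
    linear_combination -h.deriv_y
  have halg (c : K) : algebraMap K L c ∈ algebraicClosure K L := algebraMap_mem _ c
  rw [e]
  exact div_mem (sub_mem (sub_mem (add_mem (deriv_mem_algebraicClosure hy) (pow_mem hy 2))
    (mul_mem (halg _) hy)) (halg _)) (mul_mem (ofNat_mem _ 2) (pow_mem hy 2))

theorem y_mem (h : IsSolution a b θ y x) (ha : a ≠ 0) (hb : b ≠ 0)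
    (hx : x ∈ algebraicClosure K L) : y ∈ algebraicClosure K L := by
  have h0 := h.x_ne_zero ha
  have h1 := h.one_sub_x_ne_zero hb
  have h2 : (2 : L) ≠ 0 := by
    have : CharZero L := charZero_of_injective_algebraMap (algebraMap K L).injective
    simp
  have e : y = (x′ + algebraMap K L (a + b) * x - algebraMap K L a) / (2 * x * (1 - x)) := by
    rw [eq_div_iff (mul_ne_zero (mul_ne_zero h2 h0) h1)]
    linear_combination -h.deriv_x
  have halg (c : K) : algebraMap K L c ∈ algebraicClosure K L := algebraMap_mem _ c
  rw [e]
  exact div_mem (sub_mem (add_mem (deriv_mem_algebraicClosure hx) (mul_mem (halg _) hx)) (halg _))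
    (mul_mem (mul_mem (ofNat_mem _ 2) hx) (sub_mem (one_mem _) hx))

end IsSolution

namespace DependentSolution

variable [CharZero K] {a b θ : K} {y x : L}

theorem a_ne_zero (h : DependentSolution a b θ y x) : a ≠ 0 := by simpa using h.a_ne 0

theorem b_ne_zero (h : DependentSolution a b θ y x) : b ≠ 0 := by simpa using h.b_ne 0

theorem x_ne_zero (h : DependentSolution a b θ y x) : x ≠ 0 :=
  h.toIsSolution.x_ne_zero h.a_ne_zero

theorem one_sub_x_ne_zero (h : DependentSolution a b θ y x) : 1 - x ≠ 0 :=
  h.toIsSolution.one_sub_x_ne_zero h.b_ne_zero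

theorem isAlgebraic_symm (h : DependentSolution a b θ y x) : IsAlgebraic K⟮y⟯ x :=
  isAlgebraic_adjoin_symm h.transcendental_x h.transcendental_y h.isAlgebraic

/-- The degrees and subleading coefficients of the minimal polynomials of either unknown over the
field generated by the other one. -/
theorem exists_shape (h : DependentSolution a b θ y x) : ∃ i j t : ℕ, 0 < i + j ∧
    (minpoly K⟮x⟯ y).natDegree = t + 2 ∧
    ((minpoly K⟮x⟯ y).coeff (t + 1) : L) =
      i * algebraMap K L a / x - j * algebraMap K L b / (1 - x) ∧
    (minpoly K⟮y⟯ x).natDegree = i + j ∧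
    ((minpoly K⟮y⟯ x).coeff (i + j - 1) : L) =
      -j + (i * algebraMap K L a + j * algebraMap K L b) / y
        + (t + 2) / 2 * algebraMap K L θ / y ^ 2 := by
  obtain ⟨P, hP, hP0⟩ := exists_relation_of_isAlgebraic h.transcendental_x h.isAlgebraic
  obtain ⟨F, hF, hmonic, hn, hm, hF0⟩ :=
    exists_irreducible_relation h.transcendental_x h.transcendental_y hP hP0
  have hy : y′ = aevalAeval x y (velocityY a b θ) := by
    rw [h.deriv_y, velocityY]
    simp only [map_add, map_mul, map_pow, aevalAeval_C, aevalAeval_Y, map_sub, aeval_X, aeval_C,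
      map_ofNat, map_one]
    ring
  have hx : x′ = aevalAeval x y (velocityX a b) := by
    rw [h.deriv_x, velocityX]
    simp only [map_add, map_mul, map_pow, aevalAeval_C, aevalAeval_Y, map_sub, aeval_X, aeval_C,
      map_ofNat]
    ring
  obtain ⟨hdvd, hdeg, hcoeff⟩ := minpoly_of_irreducible h.transcendental_x hF hn hF0
  obtain ⟨-, hdeg', hcoeff'⟩ := minpoly_of_irreducible (x := y) (y := x) h.transcendental_y
    (algEquiv_swap_irreducible hF) hm (by rw [Bivariate.aevalAeval_swap, hF0])
  obtain ⟨G, hG⟩ := hdvd _ (by rw [← deriv_aevalAeval hy hx, hF0, map_zero])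
  rw [mul_comm] at hG
  obtain ⟨i, j, t, h1, h2, h3, h4, h5⟩ := coeff_eq_of_darboux h.θ_ne_zero hn hm hmonic hG
  refine ⟨i, j, t, by omega, by rw [hdeg, h1], ?_, by rw [hdeg', h2], ?_⟩
  · rw [hcoeff, h1]
    have hf0 : aeval x (F.coeff (t + 2)) ≠ 0 := by
      intro h0
      have := (transcendental_iff.1 h.transcendental_x) _ h0
      rw [leadingCoeff, h1, this] at hmonic
      exact not_monic_zero hmonic
    have := congrArg (aeval x) h3
    simp only [map_mul, map_sub, map_one, aeval_X, aeval_C, map_natCast] at this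
    have hx0 := h.x_ne_zero
    have hx1 := h.one_sub_x_ne_zero
    field_simp
    linear_combination this
  · have hy0 := h.y_ne_zero
    rw [hcoeff', h2, h4, h5]
    simp only [map_mul, map_add, map_neg, map_pow, map_div₀, aeval_X, aeval_C, map_natCast,
      map_ofNat]
    field_simp
    ring

end DependentSolution
end Solution

section Adjoin

variable {K L : Type*} [Field K] [Field L] [Algebra K L]

theorem adjoin_one_sub (x : L) : K⟮1 - x⟯ = K⟮x⟯ := by
  apply le_antisymm <;> rw [IntermediateField.adjoin_simple_le_iff]
  · exact sub_mem (one_mem _) (IntermediateField.mem_adjoin_simple_self K x)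
  · simpa using sub_mem (one_mem _) (IntermediateField.mem_adjoin_simple_self K (1 - x))

theorem adjoin_neg (y : L) : K⟮-y⟯ = K⟮y⟯ := by
  apply le_antisymm <;> rw [IntermediateField.adjoin_simple_le_iff]
  · exact neg_mem (IntermediateField.mem_adjoin_simple_self K y)
  · simpa using neg_mem (IntermediateField.mem_adjoin_simple_self K (-y))

theorem adjoin_div {θ : K} (hθ : θ ≠ 0) (y : L) : K⟮algebraMap K L θ / y⟯ = K⟮y⟯ := by
  have h0 : algebraMap K L θ ≠ 0 := by simpa using hθ
  apply le_antisymm <;> rw [IntermediateField.adjoin_simple_le_iff]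
  · exact div_mem (algebraMap_mem _ θ) (IntermediateField.mem_adjoin_simple_self K y)
  · have := div_mem (algebraMap_mem K⟮algebraMap K L θ / y⟯ θ)
      (IntermediateField.mem_adjoin_simple_self K (algebraMap K L θ / y))
    rwa [div_div_cancel₀ h0] at this

theorem transcendental_iff_notMem {z : L} : Transcendental K z ↔ z ∉ algebraicClosure K L := by
  rw [mem_algebraicClosure_iff]
  rfl

theorem eq_zero_of_partialFractions {x : L} (hx : Transcendental K x) {α β : K}
    (h : algebraMap K L α / x + algebraMap K L β / (1 - x) = 0) : α = 0 ∧ β = 0 := by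
  have h0 : x ≠ 0 := by
    rintro rfl
    exact hx isAlgebraic_zero
  have h1 : 1 - x ≠ 0 := by
    intro h1
    obtain rfl : x = 1 := by linear_combination -h1
    exact hx isAlgebraic_one
  have h2 : C α + C (β - α) * X = (0 : K[X]) := by
    apply transcendental_iff.1 hx
    field_simp at h
    simp only [map_add, map_mul, aeval_C, aeval_X, map_sub]
    linear_combination h
  have h3 : α = 0 := by simpa using congrArg (coeff · 0) h2
  have h4 : β - α = 0 := by simpa using congrArg (coeff · 1) h2
  exact ⟨h3, by rwa [h3, sub_zero] at h4⟩

theorem eq_zero_of_quadratic {y : L} (hy : Transcendental K y) {α β γ : K}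
    (h : algebraMap K L α + algebraMap K L β * y + algebraMap K L γ * y ^ 2 = 0) :
    α = 0 ∧ β = 0 ∧ γ = 0 := by
  have h2 : C α + C β * X + C γ * X ^ 2 = (0 : K[X]) := by
    apply transcendental_iff.1 hy
    simpa using h
  refine ⟨by simpa using congrArg (coeff · 0) h2, ?_, ?_⟩
  · simpa [coeff_X, coeff_X_pow] using congrArg (coeff · 1) h2
  · simpa [coeff_X] using congrArg (coeff · 2) h2

end Adjoin

section Symmetries

variable {K L : Type*} [Field K] [Field L] [Algebra K L] [Differential K] [Differential L]
  [DifferentialAlgebra K L] [CharZero K] {a b θ : K} {y x : L}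

namespace IsSolution

/-- The symmetry exchanging the two parameters. -/
theorem swap (h : IsSolution a b θ y x) : IsSolution b a (-θ) (-y) (1 - x) where
  deriv_a := h.deriv_b
  deriv_b := h.deriv_a
  deriv_θ := by rw [map_neg, h.deriv_θ]
  θ_ne_zero := neg_ne_zero.2 h.θ_ne_zero
  deriv_y := by
    rw [map_neg, h.deriv_y]
    simp only [map_add, map_neg]
    ring
  deriv_x := by
    rw [map_sub, h.deriv_x, Derivation.map_one_eq_zero]
    simp only [map_add]
    ring

/-- The reflection changing the sign of the parameter `a`. -/
theorem reflect (h : IsSolution a b θ y x) (ha : a ≠ 0) :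
    IsSolution (-a) b θ (y + algebraMap K L a / x) x where
  deriv_a := by rw [map_neg, h.deriv_a, neg_zero]
  deriv_b := h.deriv_b
  deriv_θ := h.deriv_θ
  θ_ne_zero := h.θ_ne_zero
  deriv_y := by
    have hx0 := h.x_ne_zero ha
    rw [map_add, Derivation.leibniz_div, h.deriv_y, h.deriv_x, deriv_algebraMap, h.deriv_a]
    simp only [map_add, map_neg, smul_eq_mul, map_zero]
    field_simp
    ring
  deriv_x := by
    have hx0 := h.x_ne_zero ha
    rw [h.deriv_x]
    simp only [map_add, map_neg]
    field_simp
    ring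

/-- The symmetry inverting `y`. -/
theorem dual (h : IsSolution a b θ y x) :
    IsSolution a (1 - b) θ (algebraMap K L θ / y)
      (-y * (y * x + algebraMap K L a) / algebraMap K L θ) where
  deriv_a := h.deriv_a
  deriv_b := by rw [map_sub, h.deriv_b, Derivation.map_one_eq_zero, sub_zero]
  deriv_θ := h.deriv_θ
  θ_ne_zero := h.θ_ne_zero
  deriv_y := by
    have hy0 := h.y_ne_zero
    have hθ0 : algebraMap K L θ ≠ 0 := by simpa using h.θ_ne_zero
    rw [Derivation.leibniz_div, h.deriv_y, deriv_algebraMap, h.deriv_θ]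
    simp only [map_add, map_sub, map_one, smul_eq_mul]
    field_simp
    ring
  deriv_x := by
    have hy0 := h.y_ne_zero
    have hθ0 : algebraMap K L θ ≠ 0 := by simpa using h.θ_ne_zero
    rw [Derivation.leibniz_div, Derivation.leibniz, map_neg, map_add, Derivation.leibniz,
      h.deriv_y, h.deriv_x, deriv_algebraMap, h.deriv_a, deriv_algebraMap, h.deriv_θ]
    simp only [map_add, map_sub, map_one, smul_eq_mul, map_zero]
    field_simp
    ring

end IsSolution

namespace DependentSolution

theorem swap (h : DependentSolution a b θ y x) : DependentSolution b a (-θ) (-y) (1 - x) where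
  toIsSolution := h.toIsSolution.swap
  a_ne := h.b_ne
  b_ne := h.a_ne
  transcendental_x := by
    rw [transcendental_iff_notMem]
    intro hx
    refine transcendental_iff_notMem.1 h.transcendental_x ?_
    simpa using sub_mem (one_mem _) hx
  transcendental_y := by
    rw [transcendental_iff_notMem]
    intro hy
    refine transcendental_iff_notMem.1 h.transcendental_y ?_
    simpa using neg_mem hy
  isAlgebraic := by
    rw [adjoin_one_sub]
    exact h.isAlgebraic.neg

theorem reflect (h : DependentSolution a b θ y x) :
    DependentSolution (-a) b θ (y + algebraMap K L a / x) x where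
  toIsSolution := h.toIsSolution.reflect h.a_ne_zero
  a_ne := fun n hn => h.a_ne (-n) (by rw [Int.cast_neg, ← hn, neg_neg])
  b_ne := h.b_ne
  transcendental_x := h.transcendental_x
  transcendental_y := by
    rw [transcendental_iff_notMem]
    exact fun hm => transcendental_iff_notMem.1 h.transcendental_x
      ((h.toIsSolution.reflect h.a_ne_zero).x_mem hm)
  isAlgebraic := h.isAlgebraic.add (by
    have := isAlgebraic_algebraMap (R := K⟮x⟯) (A := L)
      (algebraMap K K⟮x⟯ a / IntermediateField.AdjoinSimple.gen K x)
    simpa using this)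

theorem dual (h : DependentSolution a b θ y x) :
    DependentSolution a (1 - b) θ (algebraMap K L θ / y)
      (-y * (y * x + algebraMap K L a) / algebraMap K L θ) := by
  have hθ0 : algebraMap K L θ ≠ 0 := by simpa using h.θ_ne_zero
  have hb : 1 - b ≠ 0 := fun h0 => h.b_ne 1 (by rw [Int.cast_one]; linear_combination -h0)
  have hty : Transcendental K (algebraMap K L θ / y) := by
    rw [transcendental_iff_notMem]
    intro hm
    refine transcendental_iff_notMem.1 h.transcendental_y ?_
    rw [← div_div_cancel₀ hθ0 (b := y)]
    exact div_mem (algebraMap_mem _ θ) hm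
  have htx : Transcendental K (-y * (y * x + algebraMap K L a) / algebraMap K L θ) := by
    rw [transcendental_iff_notMem] at hty ⊢
    exact fun hm => hty (h.toIsSolution.dual.y_mem h.a_ne_zero hb hm)
  refine ⟨h.toIsSolution.dual, h.a_ne, fun n hn => h.b_ne (1 - n) (by
    rw [Int.cast_sub, ← hn, Int.cast_one, sub_sub_cancel]), htx, hty,
    isAlgebraic_adjoin_symm hty htx ?_⟩
  rw [adjoin_div h.θ_ne_zero]
  have hy : IsAlgebraic K⟮y⟯ y := isAlgebraic_algebraMap (IntermediateField.AdjoinSimple.gen K y)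
  have hk (c : K) : IsAlgebraic K⟮y⟯ (algebraMap K L c) :=
    isAlgebraic_algebraMap (algebraMap K K⟮y⟯ c)
  rw [div_eq_mul_inv]
  exact (hy.neg.mul ((hy.mul h.isAlgebraic_symm).add (hk a))).mul (hk θ).inv

end DependentSolution
end Symmetries

section Descent

variable {K L : Type*} [Field K] [Field L] [Algebra K L] [Differential K] [Differential L]
  [DifferentialAlgebra K L] [CharZero K] {a b θ : K} {y x : L}

/-- The numerical data attached to a dependent solution: `n = [K(x, y) : K(x)]`,
`i + j = [K(x, y) : K(y)]`, and the subleading coefficients of the two minimal polynomials. -/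
structure HasShape (a b θ : K) (y x : L) (i j n : ℕ) : Prop where
  pos : 0 < i + j
  pos' : 0 < n
  natDegree_y : (minpoly K⟮x⟯ y).natDegree = n
  coeff_y : ((minpoly K⟮x⟯ y).coeff (n - 1) : L) =
    i * algebraMap K L a / x - j * algebraMap K L b / (1 - x)
  natDegree_x : (minpoly K⟮y⟯ x).natDegree = i + j
  coeff_x : ((minpoly K⟮y⟯ x).coeff (i + j - 1) : L) =
    -j + (i * algebraMap K L a + j * algebraMap K L b) / y + n / 2 * algebraMap K L θ / y ^ 2

theorem DependentSolution.exists_hasShape (h : DependentSolution a b θ y x) :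
    ∃ i j n, HasShape a b θ y x i j n := by
  obtain ⟨i, j, t, h1, h2, h3, h4, h5⟩ := h.exists_shape
  exact ⟨i, j, t + 2, h1, by omega, h2, h3, h4, by exact_mod_cast h5⟩

/-- `coeff_minpoly_affine` over a subfield of `L`, with values in `L`. -/
theorem coeff_minpoly_of_eq {E E' : IntermediateField K L} (hE : E' = E) {z w u v : L}
    (hu : u ∈ E) (hv : v ∈ E) (hu0 : u ≠ 0) (hw : w = u * z + v) {n : ℕ} (hn : 0 < n)
    (hd : (minpoly E z).natDegree = n) :
    (minpoly E' w).natDegree = n ∧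
    ((minpoly E' w).coeff (n - 1) : L) = u * (minpoly E z).coeff (n - 1) - n * v := by
  subst hE
  obtain ⟨n, rfl⟩ : ∃ m, n = m + 1 := ⟨n - 1, by omega⟩
  have := coeff_minpoly_affine (z := z) (u := (⟨u, hu⟩ : E')) (fun h => hu0 (congrArg Subtype.val h)) ⟨v, hv⟩ hd
  have hw' : w = algebraMap E' L ⟨u, hu⟩ * z + algebraMap E' L ⟨v, hv⟩ := hw
  rw [hw', Nat.add_sub_cancel]
  refine ⟨this.1, ?_⟩
  rw [this.2]
  push_cast
  rfl

namespace DependentSolution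

variable {i j n i' j' n' : ℕ}

theorem natDegree_swap (h : DependentSolution a b θ y x) :
    (minpoly K⟮-y⟯ (1 - x)).natDegree = (minpoly K⟮y⟯ x).natDegree := by
  obtain ⟨i, j, n, hs⟩ := h.exists_hasShape
  rw [hs.natDegree_x]
  exact (coeff_minpoly_of_eq (adjoin_neg y) (neg_mem (one_mem _)) (one_mem _) (by simp)
    (by ring) hs.pos hs.natDegree_x).1

theorem hasShape_swap (h : DependentSolution a b θ y x) (hs : HasShape a b θ y x i j n) :
    HasShape b a (-θ) (-y) (1 - x) j i n := by
  obtain ⟨i', j', n', hs'⟩ := h.swap.exists_hasShape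
  obtain ⟨h1, h2⟩ := coeff_minpoly_of_eq (adjoin_one_sub x) (z := y) (w := -y) (u := -1) (v := 0)
    (neg_mem (one_mem _)) (zero_mem _) (by simp) (by ring) hs.pos' hs.natDegree_y
  obtain rfl : n' = n := by rw [← hs'.natDegree_y, h1]
  rw [hs'.coeff_y, hs.coeff_y, sub_sub_cancel] at h2
  have hx0 := h.x_ne_zero
  have hx1 := h.one_sub_x_ne_zero
  obtain ⟨h3, h4⟩ := eq_zero_of_partialFractions h.transcendental_x
    (α := (i - j') * a) (β := (i' - j) * b) (by
      simp only [map_mul, map_sub, map_natCast]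
      linear_combination h2)
  have h5 : j' = i := by
    have := (mul_eq_zero.1 h3).resolve_right h.a_ne_zero
    exact_mod_cast (sub_eq_zero.1 this).symm
  have h6 : i' = j := by
    have := (mul_eq_zero.1 h4).resolve_right h.b_ne_zero
    exact_mod_cast (sub_eq_zero.1 this)
  subst h5 h6
  exact hs'

theorem hasShape_reflect (h : DependentSolution a b θ y x) (hs : HasShape a b θ y x i j n) :
    ∃ i', i + i' = n ∧ HasShape (-a) b θ (y + algebraMap K L a / x) x i' j n := by
  obtain ⟨i', j', n', hs'⟩ := h.reflect.exists_hasShape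
  obtain ⟨h1, h2⟩ := coeff_minpoly_of_eq (E := K⟮x⟯) rfl (z := y)
    (w := y + algebraMap K L a / x) (u := 1) (v := algebraMap K L a / x) (one_mem _)
    (div_mem (algebraMap_mem _ a) (IntermediateField.mem_adjoin_simple_self K x)) one_ne_zero
    (by ring) hs.pos' hs.natDegree_y
  obtain rfl : n' = n := by rw [← hs'.natDegree_y, h1]
  rw [hs'.coeff_y, hs.coeff_y] at h2
  obtain ⟨h3, h4⟩ := eq_zero_of_partialFractions h.transcendental_x
    (α := (n' - i - i') * a) (β := (j - j') * b) (by
      simp only [map_mul, map_sub, map_natCast]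
      simp only [map_neg] at h2
      linear_combination h2)
  have h5 : i + i' = n' := by
    have := (mul_eq_zero.1 h3).resolve_right h.a_ne_zero
    have h6 : (i + i' : K) = n' := by linear_combination -this
    exact_mod_cast h6
  have h6 : j' = j := by
    have := (mul_eq_zero.1 h4).resolve_right h.b_ne_zero
    exact_mod_cast (sub_eq_zero.1 this).symm
  subst h6
  exact ⟨i', h5, hs'⟩

theorem hasShape_dual (h : DependentSolution a b θ y x) (hs : HasShape a b θ y x i j n) :
    ∃ i' j', n = 2 * j' ∧ i' + j' = i + j ∧ i' * a + j' * (1 - b) = j * (a - b) ∧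
      HasShape a (1 - b) θ (algebraMap K L θ / y)
      (-y * (y * x + algebraMap K L a) / algebraMap K L θ) i' j' (2 * j) := by
  obtain ⟨i', j', n', hs'⟩ := h.dual.exists_hasShape
  have hy0 := h.y_ne_zero
  have hθ0 : algebraMap K L θ ≠ 0 := by simpa using h.θ_ne_zero
  have hym := IntermediateField.mem_adjoin_simple_self K y
  obtain ⟨h1, h2⟩ := coeff_minpoly_of_eq (adjoin_div h.θ_ne_zero y) (z := x)
    (w := -y * (y * x + algebraMap K L a) / algebraMap K L θ) (u := -(y ^ 2 / algebraMap K L θ))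
    (v := -(algebraMap K L a * y / algebraMap K L θ))
    (neg_mem (div_mem (pow_mem hym 2) (algebraMap_mem _ θ)))
    (neg_mem (div_mem (mul_mem (algebraMap_mem _ a) hym) (algebraMap_mem _ θ)))
    (by simp [hy0, hθ0]) (by ring) hs.pos hs.natDegree_x
  have h3 : i' + j' = i + j := by rw [← hs'.natDegree_x, h1]
  rw [← h3, hs'.coeff_x, h3, hs.coeff_x] at h2
  have h20 : (2 : L) ≠ 0 := by
    have : CharZero L := charZero_of_injective_algebraMap (algebraMap K L).injective
    simp
  obtain ⟨h4, h8, h6⟩ := eq_zero_of_quadratic h.transcendental_y (α := (n - 2 * j') * θ)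
    (β := 2 * (i' * a + j' * (1 - b) - j * (a - b))) (γ := n' - 2 * j) (by
      simp only [map_mul, map_sub, map_natCast, map_add, map_ofNat, map_one]
      simp only [map_sub, map_one, Nat.cast_add] at h2
      field_simp at h2
      linear_combination h2)
  have h5 : n = 2 * j' := by
    have := (mul_eq_zero.1 h4).resolve_right h.θ_ne_zero
    exact_mod_cast (sub_eq_zero.1 this)
  have h7 : n' = 2 * j := by exact_mod_cast (sub_eq_zero.1 h6)
  have h9 := (mul_eq_zero.1 h8).resolve_left two_ne_zero
  exact ⟨i', j', h5, h3, sub_eq_zero.1 h9, h7 ▸ hs'⟩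

theorem two_mul_fst_le (h : DependentSolution a b θ y x) (hs : HasShape a b θ y x i j n)
    (hmin : ∀ (a b θ : K) (y x : L), DependentSolution a b θ y x →
      i + j ≤ (minpoly K⟮y⟯ x).natDegree) : 2 * i ≤ n := by
  obtain ⟨i', hi, hs'⟩ := h.hasShape_reflect hs
  have := hmin _ _ _ _ _ h.reflect
  rw [hs'.natDegree_x] at this
  omega

theorem eq_two_mul_snd (h : DependentSolution a b θ y x) (hs : HasShape a b θ y x i j n)
    (hmin : ∀ (a b θ : K) (y x : L), DependentSolution a b θ y x →
      i + j ≤ (minpoly K⟮y⟯ x).natDegree) : n = 2 * j := by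
  obtain ⟨i', j', h1, h2, -, hs'⟩ := h.hasShape_dual hs
  have h3 := h.swap.two_mul_fst_le (h.hasShape_swap hs) (by rwa [add_comm])
  have h4 := h.dual.swap.two_mul_fst_le (h.dual.hasShape_swap hs')
    (by rwa [add_comm j' i', h2])
  omega

theorem false (h : DependentSolution a b θ y x) : False := by
  induction hd : (minpoly K⟮y⟯ x).natDegree using Nat.strong_induction_on
    generalizing a b θ y x with
  | _ d ih =>
    obtain ⟨i, j, n, hs⟩ := h.exists_hasShape
    have hmin (a b θ : K) (y x : L) (h' : DependentSolution a b θ y x) :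
        i + j ≤ (minpoly K⟮y⟯ x).natDegree := by
      rw [← hs.natDegree_x, hd]
      by_contra hlt
      exact ih _ (not_le.1 hlt) h' rfl
    have h1 := h.eq_two_mul_snd hs hmin
    have h2 := h.swap.eq_two_mul_snd (h.hasShape_swap hs) (by rwa [add_comm])
    obtain ⟨i', j', h3, h4, h5, -⟩ := h.hasShape_dual hs
    obtain rfl : i = j := by omega
    obtain rfl : i = j' := by omega
    obtain rfl : i = i' := by omega
    have h6 : (i : K) = 0 := by linear_combination h5
    have := hs.pos
    have h7 : i = 0 := by exact_mod_cast h6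
    omega

end DependentSolution
end Descent

theorem algebraicIndependent_pair {K L : Type*} [Field K] [Field L] [Algebra K L] {x y : L}
    (hx : Transcendental K x) (hy : Transcendental K⟮x⟯ y) : AlgebraicIndependent K ![y, x] := by
  have h1 : AlgebraicIndependent K (fun _ : Unit => x) :=
    (algebraicIndependent_unique_type_iff).2 hx
  have h2 := (h1.option_iff_transcendental y).2 (by
    rw [Set.range_const]
    exact IntermediateField.transcendental_adjoin_iff.1 hy)
  have h3 := h2.comp ![none, some ()] (by
    intro i j h
    fin_cases i <;> fin_cases j <;> simp_all)
  convert h3 using 1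
  ext i
  fin_cases i <;> rfl

section Dichotomy

variable {K L : Type*} [Field K] [Field L] [Algebra K L] [Differential K] [Differential L]
  [DifferentialAlgebra K L] [CharZero K] {a b θ : K} {y x : L}

namespace IsSolution

theorem isAlgebraic_or_algebraicIndependent (h : IsSolution a b θ y x) (ha : ∀ n : ℤ, a ≠ n)
    (hb : ∀ n : ℤ, b ≠ n) :
    (IsAlgebraic K y ∧ IsAlgebraic K x) ∨ AlgebraicIndependent K ![y, x] := by
  have ha0 : a ≠ 0 := by simpa using ha 0
  have hb0 : b ≠ 0 := by simpa using hb 0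
  simp only [← mem_algebraicClosure_iff]
  by_cases hy : y ∈ algebraicClosure K L
  · exact Or.inl ⟨hy, h.x_mem hy⟩
  by_cases hx : x ∈ algebraicClosure K L
  · exact Or.inl ⟨h.y_mem ha0 hb0 hx, hx⟩
  rw [← transcendental_iff_notMem] at hx hy
  refine Or.inr (algebraicIndependent_pair hx fun hd => ?_)
  exact DependentSolution.false ⟨h, ha, hb, hx, hy, hd⟩

/-- The translation of the parameter `a` by reflections. -/
theorem one_sub (h : IsSolution a b θ y x) : IsSolution (1 - a) b θ (-(algebraMap K L θ / y))
    (1 + y * (algebraMap K L b - y * (1 - x)) / algebraMap K L θ) := by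
  have := h.swap.dual.swap
  rw [neg_neg] at this
  convert this using 1
  · rw [map_neg, neg_div_neg_eq]
  · rw [map_neg]
    ring

theorem exists_of_intCast (h : IsSolution (0 : K) b θ y x) (hy : y ∉ algebraicClosure K L)
    (n : ℤ) : ∃ y x : L, IsSolution (n : K) b θ y x ∧
      ¬(y ∈ algebraicClosure K L ∧ x ∈ algebraicClosure K L) := by
  have hk (c : K) : algebraMap K L c ∈ algebraicClosure K L := algebraMap_mem _ c
  have hneg (n : ℤ) (hn : ∃ y x : L, IsSolution (n : K) b θ y x ∧
      ¬(y ∈ algebraicClosure K L ∧ x ∈ algebraicClosure K L)) :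
      ∃ y x : L, IsSolution ((-n : ℤ) : K) b θ y x ∧
        ¬(y ∈ algebraicClosure K L ∧ x ∈ algebraicClosure K L) := by
    obtain ⟨y, x, h, hm⟩ := hn
    by_cases h0 : (n : K) = 0
    · exact ⟨y, x, by rwa [Int.cast_neg, h0, neg_zero, ← h0], hm⟩
    · have hr := h.reflect h0
      rw [← Int.cast_neg] at hr
      refine ⟨_, _, hr, fun ⟨hy, hx⟩ => hm ⟨?_, hx⟩⟩
      rw [← add_sub_cancel_right y (algebraMap K L n / x)]
      exact sub_mem hy (div_mem (hk _) hx)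
  have hone (n : ℤ) (hn : ∃ y x : L, IsSolution (n : K) b θ y x ∧
      ¬(y ∈ algebraicClosure K L ∧ x ∈ algebraicClosure K L)) :
      ∃ y x : L, IsSolution ((1 - n : ℤ) : K) b θ y x ∧
        ¬(y ∈ algebraicClosure K L ∧ x ∈ algebraicClosure K L) := by
    obtain ⟨y, x, h, hm⟩ := hn
    have hr := h.one_sub
    rw [← Int.cast_one, ← Int.cast_sub] at hr
    refine ⟨_, _, hr, fun hm' => hm ?_⟩
    have hθ0 : algebraMap K L θ ≠ 0 := by simpa using h.θ_ne_zero
    have hy : y ∈ algebraicClosure K L := by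
      rw [← div_div_cancel₀ hθ0 (b := y)]
      exact div_mem (hk θ) (by simpa using neg_mem hm'.1)
    exact ⟨hy, h.x_mem hy⟩
  induction n using Int.induction_on with
  | zero => exact ⟨y, x, by rwa [Int.cast_zero], fun hm => hy hm.1⟩
  | succ n ih =>
    have := hone _ (hneg _ ih)
    rwa [sub_neg_eq_add, add_comm] at this
  | pred n ih =>
    have := hneg _ (hone _ ih)
    rwa [neg_sub] at this

end IsSolution
end Dichotomy

section Bridge

variable {L : Type*} [Field L]

/-- The derivation `t D` attached to an additive map `D` satisfying the Leibniz rule. -/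
def eulerDerivation (D : L → L) (hadd : ∀ a b, D (a + b) = D a + D b)
    (hmul : ∀ a b, D (a * b) = a * D b + b * D a) (t : L) : Derivation ℤ L L :=
  Derivation.mk' (AddMonoidHom.mk' (fun z => t * D z) (by simp [hadd, mul_add])).toIntLinearMap
    (by
      intro a b
      change t * D (a * b) = a * (t * D b) + b * (t * D a)
      rw [hmul]
      ring)

/-- The restriction of a derivation to a stable subfield. -/
def restrictDerivation (d : Derivation ℤ L L) (K : Subfield L) (hK : ∀ a ∈ K, d a ∈ K) :
    Derivation ℤ K K :=
  Derivation.mk' (AddMonoidHom.mk' (fun z : K => (⟨d z, hK z z.2⟩ : K))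
    (fun a b => Subtype.ext (by simp))).toIntLinearMap
    (fun a b => Subtype.ext (by
      change d ((a : L) * b) = a * d b + b * d a
      simp))

end Bridge

section Construction

/-- A derivation of a domain extends to its fraction field. -/
theorem exists_derivation_extension {k A L : Type*} [CommRing k] [CommRing A] [IsDomain A]
    [Field L] [Algebra k A] [Algebra k L] [Algebra A L] [IsScalarTower k A L] [IsFractionRing A L]
    (d : Derivation k A L) : ∃ D : L → L, (∀ a b, D (a + b) = D a + D b) ∧
      (∀ a b, D (a * b) = a * D b + b * D a) ∧ ∀ a, D (algebraMap A L a) = d a := by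
  let g : A →+* TrivSqZeroExt L L :=
    { toFun := fun a => TrivSqZeroExt.inl (algebraMap A L a) + TrivSqZeroExt.inr (d a)
      map_one' := by ext <;> simp
      map_zero' := by ext <;> simp
      map_add' := fun a b => by ext <;> simp
      map_mul' := fun a b => by
        ext
        · simp
        · simp only [map_mul, Derivation.leibniz, TrivSqZeroExt.snd_mul, TrivSqZeroExt.snd_add,
            TrivSqZeroExt.fst_add, TrivSqZeroExt.fst_inl, TrivSqZeroExt.snd_inl,
            TrivSqZeroExt.fst_inr, TrivSqZeroExt.snd_inr, zero_add, add_zero, smul_eq_mul,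
            Algebra.smul_def, MulOpposite.smul_eq_mul_unop, MulOpposite.unop_op]
          ring }
  have hg (s : nonZeroDivisors A) : IsUnit (g s) := by
    rw [TrivSqZeroExt.isUnit_iff_isUnit_fst]
    simp [g]
  let f : L →+* TrivSqZeroExt L L := IsLocalization.lift hg
  have hf (a : A) : f (algebraMap A L a) = g a := IsLocalization.lift_eq hg a
  have hfst (z : L) : (f z).fst = z := by
    have : ((TrivSqZeroExt.fstHom L L L).toRingHom.comp f) = RingHom.id L := by
      apply IsLocalization.ringHom_ext (nonZeroDivisors A)
      ext a
      change (f (algebraMap A L a)).fst = _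
      simp [hf, g]
    exact congrArg (fun φ => φ z) this
  refine ⟨fun z => (f z).snd, fun a b => by simp, fun a b => ?_, fun a => by simp [hf, g]⟩
  simp only [map_mul, TrivSqZeroExt.snd_mul, hfst]
  simp [mul_comm b]

theorem deriv_mem_adjoin {k L : Type*} [Field k] [Field L] [Algebra k L] {D : L → L}
    (hadd : ∀ a b, D (a + b) = D a + D b) (hmul : ∀ a b, D (a * b) = a * D b + b * D a)
    (hC : ∀ c : k, D (algebraMap k L c) = 0) {t : L} (ht : D t = 1) {a : L} (ha : a ∈ k⟮t⟯) :
    D a ∈ k⟮t⟯ := by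
  have h0 : D 0 = 0 := by simpa using hadd 0 0
  induction ha using IntermediateField.adjoin_induction with
  | mem a ha =>
    obtain rfl : a = t := ha
    rw [ht]
    exact one_mem _
  | algebraMap c =>
    rw [hC]
    exact zero_mem _
  | add a b _ _ ha hb =>
    rw [hadd]
    exact add_mem ha hb
  | mul a b ha' hb' ha hb =>
    rw [hmul]
    exact add_mem (mul_mem ha' hb) (mul_mem hb' ha)
  | inv a ha' ha =>
    rcases eq_or_ne a 0 with rfl | ha0
    · rw [inv_zero, h0]
      exact zero_mem _
    · have h1 : D 1 = 0 := by simpa using hC 1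
      have h2 := hmul a a⁻¹
      rw [mul_inv_cancel₀ ha0, h1] at h2
      have h3 : D a⁻¹ = -(D a / a ^ 2) := by
        apply mul_left_cancel₀ ha0
        have h4 : a * (D a / a ^ 2) = a⁻¹ * D a := by field_simp
        linear_combination h4 - h2
      rw [h3]
      exact neg_mem (div_mem ha (pow_mem ha' 2))

theorem exists_riccati_extension.{u} (b s : ℂ) : ∃ (L : Type u) (_ : Field L) (_ : Algebra ℂ L)
    (D : L → L) (t z : L) (K : Subfield L), (∀ a b, D (a + b) = D a + D b) ∧
      (∀ a b, D (a * b) = a * D b + b * D a) ∧ (∀ c : ℂ, D (algebraMap ℂ L c) = 0) ∧ D t = 1 ∧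
      (∀ c : ℂ, algebraMap ℂ L c ∈ K) ∧ t ∈ K ∧ (∀ a ∈ K, D a ∈ K) ∧
      t * D z = -z ^ 2 + algebraMap ℂ L b * z + algebraMap ℂ L s * t ∧ Transcendental K z ∧
      ∀ y x : L, ¬AlgebraicIndependent K ![y, x] := by
  let A := MvPolynomial (ULift.{u} Bool) ℂ
  let L := FractionRing A
  let t : L := algebraMap A L (MvPolynomial.X ⟨false⟩)
  let z : L := algebraMap A L (MvPolynomial.X ⟨true⟩)
  have ht0 : t ≠ 0 :=
    (map_ne_zero_iff _ (IsFractionRing.injective A L)).2 (MvPolynomial.X_ne_zero _)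
  let f : ULift.{u} Bool → L := fun i =>
    if i.down then (-z ^ 2 + algebraMap ℂ L b * z + algebraMap ℂ L s * t) / t else 1
  obtain ⟨D, hadd, hmul, hD⟩ := exists_derivation_extension (MvPolynomial.mkDerivation ℂ f)
  have hC (c : ℂ) : D (algebraMap ℂ L c) = 0 := by
    rw [IsScalarTower.algebraMap_apply ℂ A L, hD, Derivation.map_algebraMap]
  have ht : D t = 1 := by
    rw [hD, MvPolynomial.mkDerivation_X]
    simp [f]
  have hz : t * D z = -z ^ 2 + algebraMap ℂ L b * z + algebraMap ℂ L s * t := by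
    have : D z = (-z ^ 2 + algebraMap ℂ L b * z + algebraMap ℂ L s * t) / t := by
      rw [hD, MvPolynomial.mkDerivation_X]
      simp [f]
    rw [this, mul_div_cancel₀ _ ht0]
  have htK := IntermediateField.mem_adjoin_simple_self ℂ t
  have hCK (c : ℂ) : algebraMap ℂ L c ∈ IntermediateField.adjoin ℂ {t} := algebraMap_mem _ c
  let K : Subfield L := (IntermediateField.adjoin ℂ {t}).toSubfield
  refine ⟨L, inferInstance, inferInstance, D, t, z, K,
    hadd, hmul, hC, ht, hCK, htK, ?_, hz, ?_, ?_⟩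
  · exact fun a => deriv_mem_adjoin hadd hmul hC ht
  · have hX : AlgebraicIndependent ℂ (fun i : ULift.{u} Bool =>
        (algebraMap A L (MvPolynomial.X i))) :=
      (MvPolynomial.algebraicIndependent_X _ ℂ).map' (f := IsScalarTower.toAlgHom ℂ A L)
        (IsFractionRing.injective A L)
    have h1 := (hX.transcendental_adjoin_iff (s := {⟨false⟩}) (i := ⟨true⟩)).2 (by simp)
    rw [Set.image_singleton] at h1
    exact IntermediateField.transcendental_adjoin_iff.2 h1
  · intro y x hi
    have hmem (p : A) : algebraMap A L p ∈ Algebra.adjoin K {z} := by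
      induction p using MvPolynomial.induction_on with
      | C c => exact Subalgebra.algebraMap_mem (Algebra.adjoin K {z}) (⟨algebraMap ℂ L c, hCK c⟩ : K)
      | add p q hp hq => rw [map_add]; exact add_mem hp hq
      | mul_X p i hp =>
        rw [map_mul]
        refine mul_mem hp ?_
        obtain ⟨_ | _⟩ := i
        · exact Subalgebra.algebraMap_mem (Algebra.adjoin K {z}) (⟨t, htK⟩ : K)
        · exact Algebra.self_mem_adjoin_singleton K z
    have : Algebra.IsAlgebraic (Algebra.adjoin K {z}) L := by
      refine ⟨fun l => ?_⟩
      obtain ⟨p, q, -, rfl⟩ := IsFractionRing.div_surjective (A := A) l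
      have halg (p : A) : IsAlgebraic (Algebra.adjoin K {z}) (algebraMap A L p) :=
        isAlgebraic_algebraMap (⟨_, hmem p⟩ : Algebra.adjoin K {z})
      rw [div_eq_mul_inv]
      exact (halg p).mul (halg q).inv
    have h1 := hi.lift_cardinalMk_le_trdeg
    have h2 : Algebra.trdeg K L ≤ Cardinal.mk ({z} : Set L) :=
      Algebra.IsAlgebraic.trdeg_le_cardinalMk K {z}
    rw [Cardinal.mk_singleton] at h2
    have h3 := h1.trans (Cardinal.lift_le.2 h2)
    simp at h3

end Construction

section Bridge

variable {L : Type*} [Field L] [Algebra ℂ L] {D : L → L} {t : L} {K : Subfield L}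

theorem isAlgebraic_or_algebraicIndependent_of_system
    (hadd : ∀ a b, D (a + b) = D a + D b) (hmul : ∀ a b, D (a * b) = a * D b + b * D a)
    (hC : ∀ c : ℂ, D (algebraMap ℂ L c) = 0) (ht : D t = 1)
    (hCK : ∀ c : ℂ, algebraMap ℂ L c ∈ K) (htK : t ∈ K) (hK : ∀ a ∈ K, D a ∈ K) {a b : ℂ}
    (ha : ∀ n : ℤ, a ≠ n) (hb : ∀ n : ℤ, b ≠ n) {y x : L}
    (hy : t * D y = 2 * y ^ 2 * x - y ^ 2 + algebraMap ℂ L (a + b) * y + t)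
    (hx : t * D x = -(2 * y * x ^ 2) + 2 * y * x - algebraMap ℂ L (a + b) * x
      + algebraMap ℂ L a) :
    (IsAlgebraic K y ∧ IsAlgebraic K x) ∨ AlgebraicIndependent K ![y, x] := by
  have hinj := (algebraMap ℂ L).injective
  have : CharZero L := charZero_of_injective_algebraMap hinj
  have h0 : D 0 = 0 := by simpa using hadd 0 0
  let : Differential L := ⟨eulerDerivation D hadd hmul t⟩
  let : Differential K := ⟨restrictDerivation (eulerDerivation D hadd hmul t) K
    fun a ha => mul_mem htK (hK a ha)⟩
  have : DifferentialAlgebra K L := ⟨fun _ => rfl⟩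
  have hsol : IsSolution (⟨algebraMap ℂ L a, hCK a⟩ : K) ⟨algebraMap ℂ L b, hCK b⟩ ⟨t, htK⟩ y x :=
    { deriv_a := Subtype.ext (by change t * D _ = 0; rw [hC, mul_zero])
      deriv_b := Subtype.ext (by change t * D _ = 0; rw [hC, mul_zero])
      deriv_θ := Subtype.ext (by change t * D t = t; rw [ht, mul_one])
      θ_ne_zero := fun h => by
        have h1 : t = 0 := congrArg Subtype.val h
        rw [h1, h0] at ht
        exact zero_ne_one ht
      deriv_y := by rw [map_add] at hy; exact hy
      deriv_x := by rw [map_add] at hx; exact hx }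
  refine hsol.isAlgebraic_or_algebraicIndependent (fun n h => ha n (hinj ?_))
    (fun n h => hb n (hinj ?_))
  all_goals
    rw [map_intCast]
    exact congrArg Subtype.val h

theorem exists_exceptional_solution (hadd : ∀ a b, D (a + b) = D a + D b)
    (hmul : ∀ a b, D (a * b) = a * D b + b * D a) (hC : ∀ c : ℂ, D (algebraMap ℂ L c) = 0)
    (ht : D t = 1) (hCK : ∀ c : ℂ, algebraMap ℂ L c ∈ K) (htK : t ∈ K) (hK : ∀ a ∈ K, D a ∈ K)
    {b s : ℂ} (hs : s ≠ 0) {z : L}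
    (hz : t * D z = -z ^ 2 + algebraMap ℂ L b * z + algebraMap ℂ L s * t)
    (hzK : Transcendental K z) (n : ℤ) :
    ∃ y x : L, ¬(IsAlgebraic K y ∧ IsAlgebraic K x) ∧
      t * D y = 2 * y ^ 2 * x - y ^ 2 + algebraMap ℂ L (n + b) * y + algebraMap ℂ L s * t ∧
      t * D x = -(2 * y * x ^ 2) + 2 * y * x - algebraMap ℂ L (n + b) * x
        + algebraMap ℂ L n := by
  have hinj := (algebraMap ℂ L).injective
  have : CharZero L := charZero_of_injective_algebraMap hinj
  have h0 : D 0 = 0 := by simpa using hadd 0 0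
  let : Differential L := ⟨eulerDerivation D hadd hmul t⟩
  let : Differential K := ⟨restrictDerivation (eulerDerivation D hadd hmul t) K
    fun a ha => mul_mem htK (hK a ha)⟩
  have : DifferentialAlgebra K L := ⟨fun _ => rfl⟩
  have hsol : IsSolution (0 : K) ⟨algebraMap ℂ L b, hCK b⟩
      ⟨algebraMap ℂ L s * t, mul_mem (hCK s) htK⟩ z 0 :=
    { deriv_a := map_zero _
      deriv_b := Subtype.ext (by change t * D _ = 0; rw [hC, mul_zero])
      deriv_θ := Subtype.ext (by
        change t * D (algebraMap ℂ L s * t) = algebraMap ℂ L s * t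
        rw [hmul, ht, hC]
        ring)
      θ_ne_zero := fun h => by
        have h1 : algebraMap ℂ L s * t = 0 := congrArg Subtype.val h
        have h2 := (mul_eq_zero.1 h1).resolve_left (by simpa using hs)
        rw [h2, h0] at ht
        exact zero_ne_one ht
      deriv_y := by
        rw [zero_add]
        change t * D z = _ + algebraMap ℂ L b * z + algebraMap ℂ L s * t
        rw [hz]
        ring
      deriv_x := by simp }
  obtain ⟨y, x, h, hm⟩ := hsol.exists_of_intCast (transcendental_iff_notMem.1 hzK) n
  simp only [mem_algebraicClosure_iff] at hm
  refine ⟨y, x, hm, ?_, ?_⟩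
  · have := h.deriv_y
    rw [map_add, map_intCast] at this ⊢
    exact this
  · have := h.deriv_x
    rw [map_add, map_intCast] at this ⊢
    exact this

end Bridge

end PainleveIII

/-- Corollary 3.8: the solution set of the Hamiltonian system `S_III'(v₁,v₂)`
(Okamoto's Hamiltonian form of the third Painlevé equation) is strongly minimal
(expressed via the dichotomy on solutions `(y,x)` in differential field extensions of `ℂ(t)`)
if and only if `v₁ + v₂ ∉ 2ℤ` and `v₁ − v₂ ∉ 2ℤ`. -/
theorem painleveIII_system_strongly_minimal_iff (v₁ v₂ : ℂ) :
    (∀ (L : Type*) [Field L] [Algebra ℂ L] (D : L → L),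
      (∀ a b : L, D (a + b) = D a + D b) →
      (∀ a b : L, D (a * b) = a * D b + b * D a) →
      (∀ c : ℂ, D (algebraMap ℂ L c) = 0) →
      ∀ t : L, D t = 1 →
      ∀ K : Subfield L,
        (∀ c : ℂ, algebraMap ℂ L c ∈ K) → t ∈ K → (∀ a ∈ K, D a ∈ K) →
      ∀ y x : L,
        t * D y = 2 * y ^ 2 * x - y ^ 2 + algebraMap ℂ L v₁ * y + t →
        t * D x = -(2 * y * x ^ 2) + 2 * y * x - algebraMap ℂ L v₁ * x
            + algebraMap ℂ L ((v₁ + v₂) / 2) →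
        ((IsAlgebraic K y ∧ IsAlgebraic K x) ∨ AlgebraicIndependent K ![y, x]))
    ↔ ((¬ ∃ n : ℤ, v₁ + v₂ = 2 * (n : ℂ)) ∧ (¬ ∃ n : ℤ, v₁ - v₂ = 2 * (n : ℂ))) := by
  have hv : v₁ = (v₁ + v₂) / 2 + (v₁ - v₂) / 2 := by ring
  constructor
  · intro H
    refine ⟨?_, ?_⟩
    · rintro ⟨n, hn⟩
      obtain ⟨L, _, _, D, t, z, K, hadd, hmul, hC, ht, hCK, htK, hK, hz, hzK, hdep⟩ :=
        PainleveIII.exists_riccati_extension ((v₁ - v₂) / 2) 1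
      obtain ⟨y, x, hm, hy, hx⟩ := PainleveIII.exists_exceptional_solution hadd hmul hC ht hCK htK
        hK one_ne_zero hz hzK n
      have ha : (n : ℂ) = (v₁ + v₂) / 2 := by linear_combination -hn / 2
      rw [ha, ← hv] at hy hx
      rw [map_one, one_mul] at hy
      exact (H L D hadd hmul hC t ht K hCK htK hK y x hy hx).elim hm (hdep y x)
    · rintro ⟨n, hn⟩
      obtain ⟨L, _, _, D, t, z, K, hadd, hmul, hC, ht, hCK, htK, hK, hz, hzK, hdep⟩ :=
        PainleveIII.exists_riccati_extension ((v₁ + v₂) / 2) (-1)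
      obtain ⟨y, x, hm, hy, hx⟩ := PainleveIII.exists_exceptional_solution hadd hmul hC ht hCK htK
        hK (neg_ne_zero.2 one_ne_zero) hz hzK n
      have ha : (n : ℂ) = (v₁ - v₂) / 2 := by linear_combination -hn / 2
      rw [ha, add_comm ((v₁ - v₂) / 2) ((v₁ + v₂) / 2), ← hv] at hy hx
      have hD0 : D 0 = 0 := by simpa using hadd 0 0
      have hDneg (w : L) : D (-w) = -D w := by
        have := hadd w (-w)
        rw [add_neg_cancel, hD0] at this
        linear_combination -this
      have hDone : D 1 = 0 := by simpa using hC 1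
      have hDsub : D (1 - x) = -D x := by rw [sub_eq_add_neg, hadd, hDneg, hDone, zero_add]
      have e : algebraMap ℂ L v₁ =
          algebraMap ℂ L ((v₁ + v₂) / 2) + algebraMap ℂ L ((v₁ - v₂) / 2) := by
        rw [← map_add, ← hv]
      refine (H L D hadd hmul hC t ht K hCK htK hK (-y) (1 - x) ?_ ?_).elim (fun h => hm ⟨?_, ?_⟩)
        (hdep _ _)
      · rw [map_neg, map_one] at hy
        rw [hDneg]
        linear_combination -hy
      · rw [hDsub]
        linear_combination e - hx
      · simpa using h.1.neg
      · simpa using isAlgebraic_one.sub h.2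
  · rintro ⟨h1, h2⟩ L _ _ D hadd hmul hC t ht K hCK htK hK y x hy hx
    rw [hv] at hy
    refine PainleveIII.isAlgebraic_or_algebraicIndependent_of_system hadd hmul hC ht hCK htK hK
      (a := (v₁ + v₂) / 2) (b := (v₁ - v₂) / 2) (fun n hn => h1 ⟨n, by linear_combination 2 * hn⟩)
      (fun n hn => h2 ⟨n, by linear_combination 2 * hn⟩) hy (by rwa [← hv])
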